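/- For every integer a ≥ 4, the MV assignment M^a V^{a+1} on the 1×(2a+2) strip of stamps satisfies c(M^a V^{a+1}) = 2a² − a + 1. -/

import Mathlib

/-- A crease direction: mountain or valley. -/
inductive MV : Type
  | M : MV
  | V : MV
deriving DecidableEq

/-- The value `σ(i)` of a layer ordering at face `i`, as a natural number
(`0` if `i` is out of range). -/
def faceVal {n : ℕ} (σ : Equiv.Perm (Fin n)) (i : ℕ) : ℕ :=
  if h : i < n then (σ ⟨i, h⟩ : Fin n) else 0

/-- Condition (1): the layer ordering respects the mountain–valley assignment. -/
def MVRelations (n : ℕ) (μ : ℕ → MV) (σ : Equiv.Perm (Fin n)) : Prop :=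
  ∀ i, i + 1 < n →
    if (μ i = MV.M ∧ Even i) ∨ (μ i = MV.V ∧ Odd i)
    then faceVal σ (i + 1) < faceVal σ i
    else faceVal σ i < faceVal σ (i + 1)

/-- `x` lies strictly between `lo` and `hi` (in either order). -/
def StrictlyBetween (x a b : ℕ) : Prop := min a b < x ∧ x < max a b

/-- Condition (2): no two creases on the same side cross. -/
def NoCrossings (n : ℕ) (σ : Equiv.Perm (Fin n)) : Prop :=
  ∀ i j, i + 1 < n → j + 1 < n → i % 2 = j % 2 →
    ¬ Xor' (StrictlyBetween (faceVal σ j) (faceVal σ i) (faceVal σ (i + 1)))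
           (StrictlyBetween (faceVal σ (j + 1)) (faceVal σ i) (faceVal σ (i + 1)))

/-- A valid layer ordering for the MV assignment `μ` on the `1 × n` strip. -/
def ValidLayerOrdering (n : ℕ) (μ : ℕ → MV) (σ : Equiv.Perm (Fin n)) : Prop :=
  MVRelations n μ σ ∧ NoCrossings n σ

/-- `c(μ)`: the number of valid layer orderings for `μ` on the `1 × n` strip. -/
noncomputable def foldCount (n : ℕ) (μ : ℕ → MV) : ℕ :=
  Nat.card {σ : Equiv.Perm (Fin n) // ValidLayerOrdering n μ σ}


namespace Stamp

/-- `z` and `w` are on the same side of the interval spanned by `x` and `y`. -/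
def NC (x y z w : ℤ) : Prop :=
  ((x < z ∧ z < y) ∨ (y < z ∧ z < x)) ↔ ((x < w ∧ w < y) ∨ (y < w ∧ w < x))

theorem NC.symm' {x y z w : ℤ} (h : NC x y z w) (h1 : x ≠ z) (h2 : x ≠ w) (h3 : y ≠ z)
    (h4 : y ≠ w) : NC z w x y := by
  unfold NC at *; omega

structure Sys (A B : ℕ) (u v : ℕ → ℤ) : Prop where
  h0 : u 0 = v 0
  mvU : ∀ i, i < A → (i % 2 = 0 → u (i+1) < u i) ∧ (i % 2 = 1 → u i < u (i+1))
  mvV : ∀ i, i < B → (i % 2 = 0 → v i < v (i+1)) ∧ (i % 2 = 1 → v (i+1) < v i)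
  ncU : ∀ i j, i < A → j < A → i % 2 = j % 2 → NC (u i) (u (i+1)) (u j) (u (j+1))
  ncV : ∀ i j, i < B → j < B → i % 2 = j % 2 → NC (v i) (v (i+1)) (v j) (v (j+1))
  ncUV : ∀ i j, i < A → j < B → i % 2 ≠ j % 2 → NC (u i) (u (i+1)) (v j) (v (j+1))
  ncVU : ∀ i j, i < A → j < B → i % 2 ≠ j % 2 → NC (v j) (v (j+1)) (u i) (u (i+1))
  injU : ∀ i j, i ≤ A → j ≤ A → i ≠ j → u i ≠ u j
  injV : ∀ i j, i ≤ B → j ≤ B → i ≠ j → v i ≠ v j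
  injUV : ∀ i j, i ≤ A → j ≤ B → 1 ≤ i + j → u i ≠ v j

theorem NC.neg {x y z w : ℤ} (h : NC x y z w) : NC (-x) (-y) (-z) (-w) := by
  unfold NC at *; omega

def ng (u : ℕ → ℤ) : ℕ → ℤ := fun k => - u k

theorem ng_ng (u : ℕ → ℤ) : ng (ng u) = u := by funext k; simp [ng]

theorem Sys.swap {A B : ℕ} {u v : ℕ → ℤ} (h : Sys A B u v) : Sys B A (ng v) (ng u) where
  h0 := by simp [ng, h.h0]
  mvU := fun i hi => by have := h.mvV i hi; simp only [ng]; omega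
  mvV := fun i hi => by have := h.mvU i hi; simp only [ng]; omega
  ncU := fun i j hi hj e => (h.ncV i j hi hj e).neg
  ncV := fun i j hi hj e => (h.ncU i j hi hj e).neg
  ncUV := fun i j hi hj e => (h.ncVU j i hj hi (Ne.symm e)).neg
  ncVU := fun i j hi hj e => (h.ncUV j i hj hi (Ne.symm e)).neg
  injU := fun i j hi hj e => by have := h.injV i j hi hj e; simp only [ng]; omega
  injV := fun i j hi hj e => by have := h.injU i j hi hj e; simp only [ng]; omega
  injUV := fun i j hi hj e => by have := h.injUV j i hj hi (by omega); simp only [ng]; omega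

/-- Face `k+1` lies beyond face `k-1`. -/
def Out (u : ℕ → ℤ) (k : ℕ) : Prop :=
  (k % 2 = 1 → u (k-1) < u (k+1)) ∧ (k % 2 = 0 → u (k+1) < u (k-1))

structure Spine (A : ℕ) (u : ℕ → ℤ) (k1 : ℕ) : Prop where
  pos : 1 ≤ k1
  le : k1 ≤ A
  out : ∀ k, 1 ≤ k → k < k1 → Out u k
  turn : k1 < A → ¬ Out u k1

/-- one-sided hypotheses -/
structure Half (A : ℕ) (u : ℕ → ℤ) : Prop where
  mv : ∀ i, i < A → (i % 2 = 0 → u (i+1) < u i) ∧ (i % 2 = 1 → u i < u (i+1))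
  nc : ∀ i j, i < A → j < A → i % 2 = j % 2 → NC (u i) (u (i+1)) (u j) (u (j+1))
  inj : ∀ i j, i ≤ A → j ≤ A → i ≠ j → u i ≠ u j

theorem Sys.half {A B : ℕ} {u v : ℕ → ℤ} (h : Sys A B u v) : Half A u := ⟨h.mvU, h.ncU, h.injU⟩

theorem Spine.unique {A : ℕ} {u : ℕ → ℤ} {k l : ℕ} (h : Spine A u k) (h' : Spine A u l) :
    k = l := by
  rcases lt_trichotomy k l with hl | hl | hl
  · exact absurd (h'.out k h.pos hl) (h.turn (lt_of_lt_of_le hl h'.le))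
  · exact hl
  · exact absurd (h.out l h'.pos hl) (h'.turn (lt_of_lt_of_le hl h.le))

theorem Spine.exists {A : ℕ} (hA : 1 ≤ A) (u : ℕ → ℤ) : ∃ k, Spine A u k := by
  classical
  have hex : ∃ k, 1 ≤ k ∧ (k = A ∨ ¬ Out u k) := ⟨A, hA, Or.inl rfl⟩
  refine ⟨Nat.find hex, (Nat.find_spec hex).1, Nat.find_min' hex ⟨hA, Or.inl rfl⟩, ?_, ?_⟩
  · intro k hk hlt
    have := Nat.find_min hex hlt
    by_contra hc
    exact this ⟨hk, Or.inr hc⟩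
  · intro hlt
    rcases (Nat.find_spec hex).2 with h | h
    · omega
    · exact h

theorem spine_lt {A : ℕ} {u : ℕ → ℤ} {k1 : ℕ} (h : Half A u) (s : Spine A u k1) :
    ∀ j, j ≤ k1 → ∀ i, i < j → (j % 2 = 0 → u i < u j) ∧ (j % 2 = 1 → u j < u i) := by
  intro j
  induction j using Nat.strong_induction_on with
  | _ j ih =>
    intro hj i hi
    obtain ⟨k, rfl⟩ : ∃ k, j = k + 1 := ⟨j - 1, by omega⟩
    have hA := s.le
    by_cases e1 : i = k
    · subst e1
      have := h.mv i (by omega)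
      omega
    · have ho := s.out k (by omega) (by omega)
      unfold Out at ho
      by_cases e2 : i = k - 1
      · subst e2; omega
      · have := ih (k-1) (by omega) (by omega) i (by omega)
        omega

theorem turn_all {A : ℕ} {u : ℕ → ℤ} {k1 : ℕ} (h : Half A u) (s : Spine A u k1) :
    ∀ k, k1 ≤ k → k < A → ¬ Out u k := by
  intro k hk
  induction k, hk using Nat.le_induction with
  | base => exact s.turn
  | succ k hk ih =>
    intro hA
    have h1 := ih (by omega)
    have hp := s.pos
    have n := h.nc (k-1) (k+1) (by omega) hA (by omega)
    have m0 := h.mv (k-1) (by omega)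
    have m1 := h.mv k (by omega)
    have m2 := h.mv (k+1) (by omega)
    have i1 := h.inj (k-1) (k+1) (by omega) (by omega) (by omega)
    obtain ⟨m, rfl⟩ : ∃ m, k = m + 1 := ⟨k - 1, by omega⟩
    simp only [Out, NC, Nat.add_sub_cancel] at *
    omega

theorem curl_lt {A : ℕ} {u : ℕ → ℤ} {k1 : ℕ} (h : Half A u) (s : Spine A u k1) :
    ∀ j, k1 < j → j ≤ A → ∀ i, k1 ≤ i + 1 → i < j →
      (i % 2 = 0 → u j < u i) ∧ (i % 2 = 1 → u i < u j) := by
  intro j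
  induction j using Nat.strong_induction_on with
  | _ j ih =>
    intro hj hA i hi hij
    have hp := s.pos
    obtain ⟨k, rfl⟩ : ∃ k, j = k + 1 := ⟨j - 1, by omega⟩
    by_cases e1 : i = k
    · subst e1
      have := h.mv i (by omega)
      omega
    · have ho := turn_all h s k (by omega) (by omega)
      have i1 := h.inj (k-1) (k+1) (by omega) (by omega) (by omega)
      unfold Out at ho
      by_cases e2 : i = k - 1
      · subst e2; omega
      · have m1 := h.mv k (by omega)
        have a1 : (i % 2 = 0 → u (k-1) < u i) ∧ (i % 2 = 1 → u i < u (k-1)) := by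
          by_cases e3 : k1 < k - 1
          · exact ih (k-1) (by omega) e3 (by omega) i (by omega) (by omega)
          · have e4 : k - 1 = k1 := by omega
            have := spine_lt h s k1 le_rfl i (by omega)
            rw [e4]; omega
        have a2 := ih k (by omega) (by omega) (by omega) i (by omega) (by omega)
        omega

theorem curl_spine {A : ℕ} {u : ℕ → ℤ} {k1 : ℕ} (h : Half A u) (s : Spine A u k1) :
    ∀ j, k1 < j → j ≤ A → ∀ i, i < k1 →
      (k1 % 2 = 0 → u i < u j) ∧ (k1 % 2 = 1 → u j < u i) := by
  intro j hj hA i hi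
  have hp := s.pos
  by_cases e1 : i + 1 = k1
  · have := curl_lt h s j hj hA i (by omega) (by omega)
    omega
  · obtain ⟨k, rfl⟩ : ∃ k, k1 = k + 2 := ⟨k1 - 2, by omega⟩
    have n := h.nc k (k+2) (by omega) (by omega) (by omega)
    have t1 := curl_lt h s (k+2+1) (by omega) (by omega) (k+1) (by omega) (by omega)
    have q1 := spine_lt h s (k+2) le_rfl k (by omega)
    have q2 := spine_lt h s (k+1) (by omega) k (by omega)
    have i1 := h.inj k (k+2+1) (by omega) (by omega) (by omega)
    have key : ((k+2) % 2 = 0 → u i ≤ u k) ∧ ((k+2) % 2 = 1 → u k ≤ u i) := by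
      rcases Nat.lt_or_ge i k with hlt | hge
      · have := spine_lt h s k (by omega) i hlt
        omega
      · obtain rfl | rfl : i = k ∨ i = k + 1 := by omega
        · simp
        · omega
    have last : ((k+2) % 2 = 0 → u (k+2+1) ≤ u j) ∧ ((k+2) % 2 = 1 → u j ≤ u (k+2+1)) := by
      by_cases e : j = k + 2 + 1
      · subst e; simp
      · have := curl_lt h s j hj hA (k+2+1) (by omega) (by omega)
        omega
    unfold NC at n
    omega

/-- The parity test deciding `u i < u j` for `i < j`. -/
def RU (k1 i j : ℕ) : ℕ := if j ≤ k1 then j else if i < k1 then k1 else i + 1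

theorem half_order {A : ℕ} {u : ℕ → ℤ} {k1 : ℕ} (h : Half A u) (s : Spine A u k1)
    {i j : ℕ} (hij : i < j) (hj : j ≤ A) : u i < u j ↔ RU k1 i j % 2 = 0 := by
  unfold RU
  split_ifs with h1 h2
  · have := spine_lt h s j h1 i hij; omega
  · have := curl_spine h s j (by omega) hj i h2; omega
  · have := curl_lt h s j (by omega) hj i (by omega) hij; omega



section UV
variable {A B : ℕ} {u v : ℕ → ℤ} {k1 k2 : ℕ}

theorem vspine_lt (h : Sys A B u v) (s2 : Spine B (ng v) k2) :
    ∀ j, j ≤ k2 → ∀ i, i < j → (j % 2 = 0 → v j < v i) ∧ (j % 2 = 1 → v i < v j) := by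
  intro j hj i hi
  have := spine_lt h.swap.half s2 j hj i hi
  simp only [ng] at this
  omega

theorem vcurl_lt (h : Sys A B u v) (s2 : Spine B (ng v) k2) :
    ∀ j, k2 < j → j ≤ B → ∀ i, k2 ≤ i + 1 → i < j →
      (i % 2 = 0 → v i < v j) ∧ (i % 2 = 1 → v j < v i) := by
  intro j hj hB i hi hij
  have := curl_lt h.swap.half s2 j hj hB i hi hij
  simp only [ng] at this
  omega

theorem vcurl_spine (h : Sys A B u v) (s2 : Spine B (ng v) k2) :
    ∀ j, k2 < j → j ≤ B → ∀ i, i < k2 →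
      (k2 % 2 = 0 → v j < v i) ∧ (k2 % 2 = 1 → v i < v j) := by
  intro j hj hB i hi
  have := curl_spine h.swap.half s2 j hj hB i hi
  simp only [ng] at this
  omega

theorem u_sign (h : Sys A B u v) (s1 : Spine A u k1) (i : ℕ) (hi : i ≤ k1) :
    (i % 2 = 0 → u 0 ≤ u i) ∧ (i % 2 = 1 → u i < u 0) := by
  rcases Nat.eq_zero_or_pos i with rfl | hp
  · simp
  · have := spine_lt h.half s1 i hi 0 hp
    omega

theorem v_sign (h : Sys A B u v) (s2 : Spine B (ng v) k2) (i : ℕ) (hi : i ≤ k2) :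
    (i % 2 = 0 → v i ≤ u 0) ∧ (i % 2 = 1 → u 0 < v i) := by
  have h0 := h.h0
  rcases Nat.eq_zero_or_pos i with rfl | hp
  · simp [h0]
  · have := vspine_lt h s2 i hi 0 hp
    omega

theorem spine_spine (h : Sys A B u v) (s1 : Spine A u k1) (s2 : Spine B (ng v) k2) :
    ∀ i j, i ≤ k1 → j ≤ k2 →
      (j < i → (i % 2 = 0 → v j < u i) ∧ (i % 2 = 1 → u i < v j)) ∧
      (i ≤ j → 1 ≤ j → (j % 2 = 0 → v j < u i) ∧ (j % 2 = 1 → u i < v j)) := by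
  intro i
  have l1 := s1.le
  have l2 := s2.le
  have h0 := h.h0
  induction i with
  | zero =>
    intro j hi hj
    refine ⟨by omega, fun _ hp => ?_⟩
    have := vspine_lt h s2 j hj 0 hp
    omega
  | succ i ih =>
    intro j hi hj
    have si := u_sign h s1 (i+1) hi
    have si' := u_sign h s1 i (by omega)
    rcases j with _ | j
    · refine ⟨fun _ => ?_, by omega⟩
      have := spine_lt h.half s1 (i+1) hi 0 (by omega)
      omega
    · have sj := v_sign h s2 (j+1) hj
      have sj' := v_sign h s2 j (by omega)
      have r := ih j (by omega) (by omega)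
      have si0 := spine_lt h.half s1 (i+1) hi 0 (by omega)
      have sj0 := vspine_lt h s2 (j+1) hj 0 (by omega)
      have ne1 := h.injUV (i+1) (j+1) (by omega) (by omega) (by omega)
      by_cases e : i % 2 = j % 2
      · constructor <;> intros <;> omega
      · have n1 := h.ncUV i j (by omega) (by omega) e
        have n2 := h.ncVU i j (by omega) (by omega) e
        have m1 := h.mvU i (by omega)
        have m2 := h.mvV j (by omega)
        unfold NC at n1 n2
        constructor
        · intro hlt
          have r1 := r.1 (by omega)
          omega
        · intro hle _
          have r1 := r.2 (by omega) (by omega)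
          omega

/-- The parity test deciding `u i < v j` on the spines. -/
def RF (i j : ℕ) : ℕ := if j < i then i else j

theorem spine_order (h : Sys A B u v) (s1 : Spine A u k1) (s2 : Spine B (ng v) k2)
    {i j : ℕ} (hi : i ≤ k1) (hj : j ≤ k2) (hp : 1 ≤ i + j) :
    u i < v j ↔ RF i j % 2 = 1 := by
  have := spine_spine h s1 s2 i j hi hj
  unfold RF
  split_ifs with c
  · have := this.1 c; omega
  · have := this.2 (by omega) (by omega); omega

/-- the curl of `u` sits in the gap just inside its outermost face. -/
theorem ucurl_gap (h : Sys A B u v) (s1 : Spine A u k1) (s2 : Spine B (ng v) k2)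
    (hk : k1 ≤ k2) (i : ℕ) (hi : k1 < i) (hA : i ≤ A) :
    (k1 % 2 = 0 → v (k1 - 1) < u i ∧ u i < u k1) ∧
    (k1 % 2 = 1 → u i < v (k1 - 1) ∧ u k1 < u i) := by
  obtain ⟨k, rfl⟩ : ∃ k, k1 = k + 1 := ⟨k1 - 1, by have := s1.pos; omega⟩
  have l2 := s2.le
  have c1 := curl_lt h.half s1 (k+1+1) (by omega) (by omega) k (by omega) (by omega)
  have n := h.ncVU (k+1) k (by omega) (by omega) (by omega)
  have r1 := (spine_spine h s1 s2 (k+1) k le_rfl (by omega)).1 (by omega)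
  have r2 := (spine_spine h s1 s2 k (k+1) (by omega) (by omega)).2 (by omega) (by omega)
  have m := h.mvV k (by omega)
  have ne := h.injUV (k+1+1) k (by omega) (by omega) (by omega)
  have d := curl_lt h.half s1 i hi hA (k+1) (by omega) (by omega)
  have last : ((k+1) % 2 = 0 → u (k+1+1) ≤ u i) ∧ ((k+1) % 2 = 1 → u i ≤ u (k+1+1)) := by
    by_cases e : i = k + 1 + 1
    · subst e; simp
    · have := curl_lt h.half s1 i hi hA (k+1+1) (by omega) (by omega)
      omega
  unfold NC at n
  simp only [Nat.add_sub_cancel]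
  omega

theorem ucurl_order (h : Sys A B u v) (s1 : Spine A u k1) (s2 : Spine B (ng v) k2)
    (hk : k1 ≤ k2) {i j : ℕ} (hA : i ≤ A) (hj : j ≤ k2) (hp : 1 ≤ i + j) :
    u i < v j ↔ RF (min i k1) j % 2 = 1 := by
  have p1 := s1.pos
  have l2 := s2.le
  rcases Nat.lt_or_ge k1 i with hi | hi
  · rw [min_eq_right hi.le]
    have g := ucurl_gap h s1 s2 hk i hi hA
    have ne := h.injUV i j hA (by omega) hp
    have r := spine_spine h s1 s2 k1 j le_rfl hj
    have r' := spine_spine h s1 s2 k1 (k1-1) le_rfl (by omega)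
    unfold RF
    split_ifs with c
    · have q : (k1 % 2 = 0 → v j ≤ v (k1-1)) ∧ (k1 % 2 = 1 → v (k1-1) ≤ v j) := by
        by_cases e : j = k1 - 1
        · subst e; simp
        · have := vspine_lt h s2 (k1-1) (by omega) j (by omega)
          omega
      omega
    · have r := r.2 (by omega) (by omega)
      have s := v_sign h s2 (k1-1) (by omega)
      have s' := v_sign h s2 j hj
      omega
  · rw [min_eq_left hi]
    exact spine_order h s1 s2 hi hj hp

/-- Non-adjacent case: the curl of `v` is just inside its outermost face. -/
theorem vcurl_order (h : Sys A B u v) (s1 : Spine A u k1) (s2 : Spine B (ng v) k2)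
    (hk : k1 ≤ k2) {i j : ℕ} (hA : i ≤ A) (hj : k2 < j) (hB : j ≤ B)
    (hc : i < k1 ∨ k2 ≠ k1 + 1) :
    u i < v j ↔ RF (min i k1) k2 % 2 = 1 := by
  have p1 := s1.pos
  have o := ucurl_order h s1 s2 hk hA (le_refl k2) (by omega)
  rw [← o]
  have c0 := vcurl_lt h s2 j hj hB k2 (by omega) hj
  have l2 := s2.le
  have ne := h.injUV i j hA hB (by omega)
  have ne2 := h.injUV i k2 hA (by omega) (by omega)
  by_cases e : k1 = k2
  · -- symmetric situation
    subst e
    have s1' : Spine A (ng (ng u)) k1 := by rw [ng_ng]; exact s1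
    have g := ucurl_gap h.swap s2 s1' le_rfl j hj hB
    simp only [ng] at g
    have g2 : (k1 % 2 = 0 → u (k1-1) ≤ u i) ∧ (k1 % 2 = 1 → u i ≤ u (k1-1)) := by
      rcases lt_trichotomy i (k1-1) with hl | rfl | hl
      · have := spine_lt h.half s1 (k1-1) (by omega) i hl
        omega
      · simp
      · by_cases e : i = k1
        · subst e
          have := spine_lt h.half s1 i (by omega) (i-1) (by omega)
          omega
        · have := curl_spine h.half s1 i (by omega) hA (k1-1) (by omega)
          omega
    omega
  · have o' : RF (min i k1) k2 % 2 = k2 % 2 := by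
      unfold RF; split_ifs <;> omega
    rw [o'] at o
    have c2 := vcurl_spine h s2 j hj hB (k2-2) (by omega)
    have key : (k2 % 2 = 0 → v (k2-2) ≤ u i) ∧ (k2 % 2 = 1 → u i ≤ v (k2-2)) := by
      by_cases hz : i = 0 ∧ k2 = 2
      · obtain ⟨rfl, rfl⟩ := hz
        have := h.h0
        simp only [Nat.sub_self]
        omega
      · have oo2 := ucurl_order h s1 s2 hk (j := k2 - 2) hA (by omega) (by omega)
        have : RF (min i k1) (k2-2) % 2 = k2 % 2 := by
          unfold RF; split_ifs <;> omega
        rw [this] at oo2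
        omega
    omega

/-- Face `k2+j` of the `v`-curl is outside face `k1+j` of the `u`-curl. -/
def Acc (u v : ℕ → ℤ) (k1 k2 j : ℕ) : Prop :=
  ((k1+j) % 2 = 0 → u (k1+j) < v (k2+j)) ∧ ((k1+j) % 2 = 1 → v (k2+j) < u (k1+j))

structure TC (B : ℕ) (u v : ℕ → ℤ) (k1 k2 t : ℕ) : Prop where
  adj : k2 = k1 + 1 → t + k2 ≤ B ∧ (∀ j, j ≤ t → Acc u v k1 k2 j) ∧
    (t + k2 < B → ¬ Acc u v k1 k2 (t+1))
  nadj : k2 ≠ k1 + 1 → t = 0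

theorem TC.unique {t t' : ℕ} (h : TC B u v k1 k2 t) (h' : TC B u v k1 k2 t') : t = t' := by
  by_cases e : k2 = k1 + 1
  · obtain ⟨x, y, z⟩ := h.adj e
    obtain ⟨x', y', z'⟩ := h'.adj e
    rcases lt_trichotomy t t' with hl | hl | hl
    · exact absurd (y' (t+1) hl) (z (by omega))
    · exact hl
    · exact absurd (y (t'+1) hl) (z' (by omega))
  · rw [h.nadj e, h'.nadj e]

theorem acc_zero (h : Sys A B u v) (s1 : Spine A u k1) (s2 : Spine B (ng v) k2)
    (e : k2 = k1 + 1) : Acc u v k1 k2 0 := by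
  subst e
  have := (spine_spine h s1 s2 k1 (k1+1) le_rfl le_rfl).2 (by omega) (by omega)
  simp only [Acc, Nat.add_zero]
  omega

theorem TC.exists (h : Sys A B u v) (s1 : Spine A u k1) (s2 : Spine B (ng v) k2) :
    ∃ t, TC B u v k1 k2 t := by
  classical
  by_cases e : k2 = k1 + 1
  · have a0 := acc_zero h s1 s2 e
    have l2 := s2.le
    have hex : ∃ t, t + k2 = B ∨ ¬ Acc u v k1 k2 (t+1) := ⟨B - k2, Or.inl (by omega)⟩
    refine ⟨Nat.find hex, fun _ => ⟨?_, ?_, ?_⟩, fun h => absurd e h⟩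
    · have := Nat.find_min' hex (m := B - k2) (Or.inl (by omega))
      omega
    · intro j hj
      rcases j with _ | j
      · exact a0
      · have := Nat.find_min hex (m := j) (by omega)
        by_contra hc
        exact this (Or.inr hc)
    · intro hlt
      rcases Nat.find_spec hex with h | h
      · omega
      · exact h
  · exact ⟨0, fun h => absurd h e, fun _ => rfl⟩

/-- accompanying faces are squeezed between consecutive turns of the `u` curl -/
theorem acc_chain (h : Sys A B u v) (s1 : Spine A u k1) (s2 : Spine B (ng v) (k1+1))
    {t : ℕ} (htB : t + (k1+1) ≤ B) (hBA : B ≤ A + 1)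
    (hacc : ∀ j, j ≤ t → Acc u v k1 (k1+1) j) :
    ∀ j, 1 ≤ j → j ≤ t → ((k1+j) % 2 = 0 → v (k1+1+j) < u (k1+j-2)) ∧
      ((k1+j) % 2 = 1 → u (k1+j-2) < v (k1+1+j)) := by
  intro j hj
  have p1 := s1.pos
  induction j, hj using Nat.le_induction with
  | base =>
    intro ht
    have c := vcurl_spine h s2 (k1+1+1) (by omega) (by omega) (k1-1) (by omega)
    have g := spine_spine h s1 s2 (k1-1) (k1-1) (by omega) (by omega)
    have h0 := h.h0
    have : k1 + 1 - 2 = k1 - 1 := by omega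
    rw [this]
    by_cases e : k1 = 1
    · subst e; simp at *; omega
    · have g := g.2 (by omega) (by omega)
      omega
  | succ j hj ih =>
    intro ht
    have i1 := ih (by omega)
    have a1 := hacc j (by omega)
    have a2 := hacc (j+1) (by omega)
    obtain ⟨m, hm⟩ : ∃ m, k1 + j = m + 2 := ⟨k1 + j - 2, by omega⟩
    have n := h.ncUV m (k1+1+j) (by omega) (by omega) (by omega)
    have m1 := h.mvU m (by omega)
    have m2 := h.mvU (m+1) (by omega)
    have m3 := h.mvV (k1+1+j) (by omega)
    have ne := h.injUV (m+1) (k1+1+j+1) (by omega) (by omega) (by omega)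
    have e1 : k1 + (j + 1) = m + 3 := by omega
    have e2 : k1 + 1 + (j + 1) = k1 + 1 + j + 1 := by omega
    simp only [Acc, NC, hm, e1, e2, show m + 1 + 1 = m + 2 from rfl] at *
    have e3 : m + 2 - 2 = m := by omega
    have e4 : m + 3 - 2 = m + 1 := by omega
    simp only [e3, e4] at *
    omega

theorem acc_order (h : Sys A B u v) (s1 : Spine A u k1) (s2 : Spine B (ng v) (k1+1))
    {t : ℕ} (htB : t + (k1+1) ≤ B) (hBA : B ≤ A + 1)
    (hacc : ∀ j, j ≤ t → Acc u v k1 (k1+1) j) {d i : ℕ} (hd : d ≤ t) (hi : k1 ≤ i)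
    (hA : i ≤ A) :
    (k1 + d ≤ i → ((k1+d) % 2 = 0 → u i < v (k1+1+d)) ∧ ((k1+d) % 2 = 1 → v (k1+1+d) < u i)) ∧
    (i < k1 + d → (i % 2 = 0 → v (k1+1+d) < u i) ∧ (i % 2 = 1 → u i < v (k1+1+d))) := by
  have a1 := hacc d hd
  unfold Acc at a1
  constructor
  · intro hle
    by_cases e : i = k1 + d
    · subst e; omega
    · have := curl_lt h.half s1 i (by omega) hA (k1+d) (by omega) (by omega)
      omega
  · intro hlt
    by_cases e : (k1 + d) % 2 = i % 2
    · have c := acc_chain h s1 s2 htB hBA hacc d (by omega) hd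
      by_cases e : i = k1 + d - 2
      · subst e; omega
      · have := curl_lt h.half s1 (k1+d-2) (by omega) (by omega) i (by omega) (by omega)
        omega
    · have := curl_lt h.half s1 (k1+d) (by omega) (by omega) i (by omega) (by omega)
      omega

/-- The parity test deciding `u i < v j` in the doubly curled zone. -/
def RA (k1 t d i : ℕ) : ℕ := if k1 + min d t ≤ i then k1 + min d t + 1 else i

theorem adj_order (h : Sys A B u v) (s1 : Spine A u k1) (s2 : Spine B (ng v) k2)
    {t : ℕ} (e : k2 = k1 + 1) (tc : TC B u v k1 k2 t) (hBA : B ≤ A + 1) {d i : ℕ}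
    (hd : k2 + d ≤ B) (hi : k1 ≤ i) (hA : i ≤ A) :
    u i < v (k2 + d) ↔ RA k1 t d i % 2 = 1 := by
  obtain ⟨x, y, z⟩ := tc.adj e
  subst e
  unfold RA
  have p1 := s1.pos
  by_cases hdt : d ≤ t
  · rw [min_eq_left hdt]
    have := acc_order h s1 s2 x hBA y hdt hi hA
    split_ifs <;> omega
  · rw [min_eq_right (by omega)]
    have o := acc_order h s1 s2 x hBA y (le_refl t) hi hA
    have o1 := acc_order h s1 s2 x hBA y (le_refl t) (i := k1+t) (by omega) (by omega)
    have z := z (by omega)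
    have n := h.ncUV (k1+t) (k1+1+t) (by omega) (by omega) (by omega)
    have m1 := h.mvU (k1+t) (by omega)
    have m2 := h.mvV (k1+1+t) (by omega)
    have ne1 := h.injUV (k1+t+1) (k1+1+t+1) (by omega) (by omega) (by omega)
    have ne2 := h.injUV (k1+t) (k1+1+t+1) (by omega) (by omega) (by omega)
    have c0 := vcurl_lt h s2 (k1+1+d) (by omega) (by omega) (k1+1+t) (by omega) (by omega)
    have c1 : ((k1+t) % 2 = 0 → v (k1+1+t+1) ≤ v (k1+1+d)) ∧
        ((k1+t) % 2 = 1 → v (k1+1+d) ≤ v (k1+1+t+1)) := by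
      by_cases e : d = t + 1
      · subst e
        simp [Nat.add_assoc]
      · have := vcurl_lt h s2 (k1+1+d) (by omega) (by omega) (k1+1+t+1) (by omega) (by omega)
        omega
    have e1 : k1 + (t+1) = k1 + t + 1 := rfl
    have e2 : k1 + 1 + (t+1) = k1 + 1 + t + 1 := rfl
    simp only [Acc, NC, e1, e2] at z n
    have key : ((k1+t) % 2 = 0 → u (k1+t) < v (k1+1+t+1)) ∧
        ((k1+t) % 2 = 1 → v (k1+1+t+1) < u (k1+t)) := by
      omega
    have c3 : i ≠ k1 + t → (i < k1 + t → (i % 2 = 0 → u (k1+t) < u i) ∧ (i % 2 = 1 → u i < u (k1+t))) ∧ 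
        (k1 + t < i → ((k1 + t) % 2 = 0 → u i < u (k1+t)) ∧ ((k1+t) % 2 = 1 → u (k1+t) < u i)) := by
      intro _
      constructor
      · intro hlt
        exact curl_lt h.half s1 (k1+t) (by omega) (by omega) i (by omega) hlt
      · intro hlt
        exact curl_lt h.half s1 i (by omega) (by omega) (k1+t) (by omega) hlt
    by_cases e : i = k1 + t
    · subst e
      simp only [le_refl, if_true]
      omega
    · have c3 := c3 e
      clear z n m1 m2 ne1 ne2
      split_ifs <;> omega

end UV

section final
variable {A B : ℕ} {u v u' v' : ℕ → ℤ} {k1 k2 t : ℕ}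

/-- For `k1 ≤ k2`, the comparison of `u i` and `v j` is determined. -/
theorem uv_det (hBA : B ≤ A + 1) (hk : k1 ≤ k2)
    (h : Sys A B u v) (s1 : Spine A u k1) (s2 : Spine B (ng v) k2) (tc : TC B u v k1 k2 t)
    (h' : Sys A B u' v') (s1' : Spine A u' k1) (s2' : Spine B (ng v') k2)
    (tc' : TC B u' v' k1 k2 t) {i j : ℕ} (hi : i ≤ A) (hj : j ≤ B) :
    u i < v j ↔ u' i < v' j := by
  have h0 := h.h0
  have h0' := h'.h0
  have p1 := s1.pos
  by_cases hp : 1 ≤ i + j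
  · by_cases c1 : j ≤ k2
    · rw [ucurl_order h s1 s2 hk hi c1 hp, ucurl_order h' s1' s2' hk hi c1 hp]
    · by_cases c2 : i < k1 ∨ k2 ≠ k1 + 1
      · rw [vcurl_order h s1 s2 hk hi (by omega) hj c2,
          vcurl_order h' s1' s2' hk hi (by omega) hj c2]
      · obtain ⟨d, rfl⟩ : ∃ d, j = k2 + d := ⟨j - k2, by omega⟩
        rw [adj_order h s1 s2 (by omega) tc hBA hj (by omega) hi,
          adj_order h' s1' s2' (by omega) tc' hBA hj (by omega) hi]
  · obtain ⟨rfl, rfl⟩ : i = 0 ∧ j = 0 := by omega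
    omega

/-- Full configuration. -/
structure Conf (A B : ℕ) (u v : ℕ → ℤ) (k1 k2 t : ℕ) : Prop where
  s1 : Spine A u k1
  s2 : Spine B (ng v) k2
  tle : k1 ≤ k2 → TC B u v k1 k2 t
  tgt : k2 < k1 → TC A (ng v) (ng u) k2 k1 t

theorem Conf.exists (hA : 1 ≤ A) (hB : 1 ≤ B) (h : Sys A B u v) :
    ∃ k1 k2 t, Conf A B u v k1 k2 t := by
  obtain ⟨k1, s1⟩ := Spine.exists hA u
  obtain ⟨k2, s2⟩ := Spine.exists hB (ng v)
  rcases Nat.lt_or_ge k2 k1 with hlt | hge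
  · obtain ⟨t, ht⟩ := TC.exists h.swap s2 (by rw [ng_ng]; exact s1)
    exact ⟨k1, k2, t, s1, s2, by omega, fun _ => ht⟩
  · obtain ⟨t, ht⟩ := TC.exists h s1 s2
    exact ⟨k1, k2, t, s1, s2, fun _ => ht, by omega⟩

theorem Conf.unique {l1 l2 t' : ℕ} (c : Conf A B u v k1 k2 t) (c' : Conf A B u v l1 l2 t') :
    k1 = l1 ∧ k2 = l2 ∧ t = t' := by
  obtain rfl := c.s1.unique c'.s1
  obtain rfl := c.s2.unique c'.s2
  refine ⟨rfl, rfl, ?_⟩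
  rcases Nat.lt_or_ge k2 k1 with hlt | hge
  · exact (c.tgt hlt).unique (c'.tgt hlt)
  · exact (c.tle hge).unique (c'.tle hge)

theorem Conf.det (hBA : B ≤ A + 1) (hAB : A ≤ B + 1)
    (h : Sys A B u v) (c : Conf A B u v k1 k2 t)
    (h' : Sys A B u' v') (c' : Conf A B u' v' k1 k2 t) {i j : ℕ} (hi : i ≤ A) (hj : j ≤ B) :
    u i < v j ↔ u' i < v' j := by
  rcases Nat.lt_or_ge k2 k1 with hlt | hge
  · have := uv_det hAB hlt.le h.swap c.s2 (by rw [ng_ng]; exact c.s1) (c.tgt hlt)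
      h'.swap c'.s2 (by rw [ng_ng]; exact c'.s1) (c'.tgt hlt) hj hi
    simpa [ng] using this
  · exact uv_det hBA hge h c.s1 c.s2 (c.tle hge) h' c'.s1 c'.s2 (c'.tle hge) hi hj

theorem half_det (h : Half A u) (s : Spine A u k1) (h' : Half A u') (s' : Spine A u' k1)
    {i j : ℕ} (hi : i ≤ A) (hj : j ≤ A) : u i < u j ↔ u' i < u' j := by
  rcases lt_trichotomy i j with hl | rfl | hl
  · rw [half_order h s hl hj, half_order h' s' hl hj]
  · simp
  · have a := half_order h s hl hi
    have b := half_order h' s' hl hi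
    have := h.inj i j hi hj (by omega)
    have := h'.inj i j hi hj (by omega)
    omega

end final


theorem mkSys {A B : ℕ} {u v : ℕ → ℤ} (h0 : u 0 = v 0)
    (mvU : ∀ i, i < A → (i % 2 = 0 → u (i+1) < u i) ∧ (i % 2 = 1 → u i < u (i+1)))
    (mvV : ∀ i, i < B → (i % 2 = 0 → v i < v (i+1)) ∧ (i % 2 = 1 → v (i+1) < v i))
    (ncU : ∀ i j, i < A → j < A → i % 2 = j % 2 → NC (u i) (u (i+1)) (u j) (u (j+1)))
    (ncV : ∀ i j, i < B → j < B → i % 2 = j % 2 → NC (v i) (v (i+1)) (v j) (v (j+1)))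
    (ncUV : ∀ i j, i < A → j < B → i % 2 ≠ j % 2 → NC (u i) (u (i+1)) (v j) (v (j+1)))
    (injU : ∀ i j, i ≤ A → j ≤ A → i < j → u i ≠ u j)
    (injV : ∀ i j, i ≤ B → j ≤ B → i < j → v i ≠ v j)
    (injUV : ∀ i j, i ≤ A → j ≤ B → 1 ≤ i + j → u i ≠ v j) : Sys A B u v where
  h0 := h0
  mvU := mvU
  mvV := mvV
  ncU := ncU
  ncV := ncV
  ncUV := ncUV
  ncVU := fun i j hi hj e => (ncUV i j hi hj e).symm'
    (injUV _ _ (by omega) (by omega) (by omega)) (injUV _ _ (by omega) (by omega) (by omega))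
    (injUV _ _ (by omega) (by omega) (by omega)) (injUV _ _ (by omega) (by omega) (by omega))
  injU := fun i j hi hj e => by
    rcases lt_or_gt_of_ne e with h | h
    · exact injU i j hi hj h
    · exact (injU j i hj hi h).symm
  injV := fun i j hi hj e => by
    rcases lt_or_gt_of_ne e with h | h
    · exact injV i j hi hj h
    · exact (injV j i hj hi h).symm
  injUV := injUV

def sg (k : ℕ) (x : ℤ) : ℤ := if k % 2 = 0 then x else -x

/-- Separate-curl model, `u` half. -/
def U0 (A k1 k : ℕ) : ℤ :=
  if k < k1 then sg k k
  else sg k1 (if k % 2 = k1 % 2 then 2 * A + 2 - k else k)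

def V0 (A B k1 k2 l : ℕ) : ℤ :=
  if l < k1 then -sg l l
  else if l < k2 then -sg l (l + 2 * (A - k1) + 2)
  else -sg k2 (if l % 2 = k2 % 2 then 2 * B + 2 - l + 2 * (A - k1) + 2 else l + 2 * (A - k1) + 2)

section sep
variable {A B k1 k2 : ℕ}

theorem U0_val (k : ℕ) :
    (k < k1 ∧ ((k % 2 = 0 ∧ U0 A k1 k = k) ∨ (k % 2 = 1 ∧ U0 A k1 k = -k))) ∨
    (k1 ≤ k ∧ ((k1 % 2 = 0 ∧ k % 2 = 0 ∧ U0 A k1 k = 2 * A + 2 - k) ∨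
      (k1 % 2 = 0 ∧ k % 2 = 1 ∧ U0 A k1 k = k) ∨
      (k1 % 2 = 1 ∧ k % 2 = 1 ∧ U0 A k1 k = -(2 * A + 2 - k)) ∨
      (k1 % 2 = 1 ∧ k % 2 = 0 ∧ U0 A k1 k = -k))) := by
  unfold U0 sg
  split_ifs <;> omega

theorem V0_a {l : ℕ} (h : l < k1) : V0 A B k1 k2 l = -sg l l := by
  simp [V0, h]

theorem V0_b {l : ℕ} (h : k1 ≤ l) (h' : l < k2) :
    V0 A B k1 k2 l = -sg l (l + 2 * (A - k1) + 2) := by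
  simp [V0, not_lt.mpr h, h']

theorem V0_c {l : ℕ} (h : k1 ≤ l) (h' : k2 ≤ l) :
    V0 A B k1 k2 l = -sg k2 (if l % 2 = k2 % 2 then 2 * B + 2 - l + 2 * (A - k1) + 2
      else l + 2 * (A - k1) + 2) := by
  simp [V0, not_lt.mpr h, not_lt.mpr h']

theorem V0_val (h3 : k1 ≤ k2) (l : ℕ) :
    (l < k2 ∧ l < k1 ∧ ((l % 2 = 1 ∧ V0 A B k1 k2 l = l) ∨ (l % 2 = 0 ∧ V0 A B k1 k2 l = -l))) ∨
    (l < k2 ∧ k1 ≤ l ∧ ((l % 2 = 1 ∧ V0 A B k1 k2 l = l + 2 * (A - k1) + 2) ∨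
      (l % 2 = 0 ∧ V0 A B k1 k2 l = -(l + 2 * (A - k1) + 2)))) ∨
    (k2 ≤ l ∧ ((k2 % 2 = 1 ∧ l % 2 = 1 ∧ V0 A B k1 k2 l = 2 * B + 2 - l + 2 * (A - k1) + 2) ∨
      (k2 % 2 = 1 ∧ l % 2 = 0 ∧ V0 A B k1 k2 l = l + 2 * (A - k1) + 2) ∨
      (k2 % 2 = 0 ∧ l % 2 = 0 ∧ V0 A B k1 k2 l = -(2 * B + 2 - l + 2 * (A - k1) + 2)) ∨
      (k2 % 2 = 0 ∧ l % 2 = 1 ∧ V0 A B k1 k2 l = -(l + 2 * (A - k1) + 2)))) := by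
  rcases Nat.lt_or_ge l k1 with h | h
  · left
    rw [V0_a h]
    unfold sg
    refine ⟨by omega, h, ?_⟩
    rcases Nat.mod_two_eq_zero_or_one l with e | e <;> simp [e]
  · rcases Nat.lt_or_ge l k2 with h' | h'
    · right; left
      rw [V0_b h h']
      unfold sg
      refine ⟨h', h, ?_⟩
      rcases Nat.mod_two_eq_zero_or_one l with e | e <;> simp [e]
    · right; right
      rw [V0_c h h']
      unfold sg
      refine ⟨h', ?_⟩
      rcases Nat.mod_two_eq_zero_or_one l with e | e <;>
      rcases Nat.mod_two_eq_zero_or_one k2 with e' | e' <;> simp [e, e']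

theorem U0_crease (i : ℕ) :
    (i + 1 < k1 ∧ i % 2 = 0 ∧ U0 A k1 i = i ∧ U0 A k1 (i+1) = -(i+1)) ∨
    (i + 1 < k1 ∧ i % 2 = 1 ∧ U0 A k1 i = -i ∧ U0 A k1 (i+1) = i+1) ∨
    (i + 1 = k1 ∧ i % 2 = 0 ∧ U0 A k1 i = i ∧ U0 A k1 (i+1) = -(2*A+1-i)) ∨
    (i + 1 = k1 ∧ i % 2 = 1 ∧ U0 A k1 i = -i ∧ U0 A k1 (i+1) = 2*A+1-i) ∨
    (k1 ≤ i ∧ k1 % 2 = 0 ∧ i % 2 = 0 ∧ U0 A k1 i = 2*A+2-i ∧ U0 A k1 (i+1) = i+1) ∨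
    (k1 ≤ i ∧ k1 % 2 = 0 ∧ i % 2 = 1 ∧ U0 A k1 i = i ∧ U0 A k1 (i+1) = 2*A+1-i) ∨
    (k1 ≤ i ∧ k1 % 2 = 1 ∧ i % 2 = 1 ∧ U0 A k1 i = -(2*A+2-i) ∧ U0 A k1 (i+1) = -(i+1)) ∨
    (k1 ≤ i ∧ k1 % 2 = 1 ∧ i % 2 = 0 ∧ U0 A k1 i = -i ∧ U0 A k1 (i+1) = -(2*A+1-i)) := by
  have a1 := U0_val (A := A) (k1 := k1) i
  have a2 := U0_val (A := A) (k1 := k1) (i+1)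
  generalize U0 A k1 i = x at *
  generalize U0 A k1 (i+1) = y at *
  rcases lt_trichotomy (i+1) k1 with h | h | h
  · rcases Nat.mod_two_eq_zero_or_one i with e | e
    · exact Or.inl ⟨h, e, by omega, by omega⟩
    · exact Or.inr (Or.inl ⟨h, e, by omega, by omega⟩)
  · rcases Nat.mod_two_eq_zero_or_one i with e | e
    · exact Or.inr (Or.inr (Or.inl ⟨h, e, by omega, by omega⟩))
    · exact Or.inr (Or.inr (Or.inr (Or.inl ⟨h, e, by omega, by omega⟩)))
  · have h' : k1 ≤ i := by omega
    rcases Nat.mod_two_eq_zero_or_one k1 with e' | e' <;>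
    rcases Nat.mod_two_eq_zero_or_one i with e | e
    · exact Or.inr (Or.inr (Or.inr (Or.inr (Or.inl ⟨h', e', e, by omega, by omega⟩))))
    · exact Or.inr (Or.inr (Or.inr (Or.inr (Or.inr (Or.inl ⟨h', e', e, by omega, by omega⟩)))))
    · exact Or.inr (Or.inr (Or.inr (Or.inr (Or.inr (Or.inr (Or.inr (⟨h', e', e, by omega, by omega⟩)))))))
    · exact Or.inr (Or.inr (Or.inr (Or.inr (Or.inr (Or.inr (Or.inl ⟨h', e', e, by omega, by omega⟩))))))

/-- Description of a crease of `V0`; `x`, `y` are levels. -/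
theorem V0_crease (h3 : k1 ≤ k2) (i : ℕ) : ∃ x y : ℤ,
    ((i < k1 ∧ x = i) ∨ (k1 ≤ i ∧ x = i + 2 * (A - k1) + 2)) ∧
    ((i + 1 < k1 ∧ y = i+1) ∨ (k1 ≤ i + 1 ∧ y = i + 1 + 2 * (A - k1) + 2)) ∧
    ((i + 1 < k2 ∧ i % 2 = 0 ∧ V0 A B k1 k2 i = -x ∧ V0 A B k1 k2 (i+1) = y) ∨
    (i + 1 < k2 ∧ i % 2 = 1 ∧ V0 A B k1 k2 i = x ∧ V0 A B k1 k2 (i+1) = -y) ∨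
    (i + 1 = k2 ∧ i % 2 = 0 ∧ V0 A B k1 k2 i = -x ∧
      V0 A B k1 k2 (i+1) = 2 * B + 1 - i + 2 * (A - k1) + 2) ∨
    (i + 1 = k2 ∧ i % 2 = 1 ∧ V0 A B k1 k2 i = x ∧
      V0 A B k1 k2 (i+1) = -(2 * B + 1 - i + 2 * (A - k1) + 2)) ∨
    (k2 ≤ i ∧ k2 % 2 = 1 ∧ i % 2 = 1 ∧ V0 A B k1 k2 i = 2 * B + 2 - i + 2 * (A - k1) + 2 ∧
      V0 A B k1 k2 (i+1) = y) ∨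
    (k2 ≤ i ∧ k2 % 2 = 1 ∧ i % 2 = 0 ∧ V0 A B k1 k2 i = x ∧
      V0 A B k1 k2 (i+1) = 2 * B + 1 - i + 2 * (A - k1) + 2) ∨
    (k2 ≤ i ∧ k2 % 2 = 0 ∧ i % 2 = 0 ∧ V0 A B k1 k2 i = -(2 * B + 2 - i + 2 * (A - k1) + 2) ∧
      V0 A B k1 k2 (i+1) = -y) ∨
    (k2 ≤ i ∧ k2 % 2 = 0 ∧ i % 2 = 1 ∧ V0 A B k1 k2 i = -x ∧
      V0 A B k1 k2 (i+1) = -(2 * B + 1 - i + 2 * (A - k1) + 2))) := by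
  have a1 := V0_val (A := A) (B := B) h3 i
  have a2 := V0_val (A := A) (B := B) h3 (i+1)
  obtain ⟨p, hp⟩ : ∃ p : ℤ, (i < k1 ∧ p = i) ∨ (k1 ≤ i ∧ p = i + 2 * (A - k1) + 2) := by
    rcases Nat.lt_or_ge i k1 with h | h
    · exact ⟨_, Or.inl ⟨h, rfl⟩⟩
    · exact ⟨_, Or.inr ⟨h, rfl⟩⟩
  obtain ⟨q, hq⟩ : ∃ q : ℤ, (i + 1 < k1 ∧ q = i + 1) ∨
      (k1 ≤ i + 1 ∧ q = i + 1 + 2 * (A - k1) + 2) := by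
    rcases Nat.lt_or_ge (i+1) k1 with h | h
    · exact ⟨_, Or.inl ⟨h, rfl⟩⟩
    · exact ⟨_, Or.inr ⟨h, rfl⟩⟩
  refine ⟨p, q, hp, hq, ?_⟩
  generalize V0 A B k1 k2 i = x at *
  generalize V0 A B k1 k2 (i+1) = y at *
  rcases lt_trichotomy (i+1) k2 with h | h | h
  · rcases Nat.mod_two_eq_zero_or_one i with e | e
    · exact Or.inl ⟨h, e, by omega, by omega⟩
    · exact Or.inr (Or.inl ⟨h, e, by omega, by omega⟩)
  · rcases Nat.mod_two_eq_zero_or_one i with e | e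
    · exact Or.inr (Or.inr (Or.inl ⟨h, e, by omega, by omega⟩))
    · exact Or.inr (Or.inr (Or.inr (Or.inl ⟨h, e, by omega, by omega⟩)))
  · have h' : k2 ≤ i := by omega
    rcases Nat.mod_two_eq_zero_or_one k2 with e' | e' <;>
    rcases Nat.mod_two_eq_zero_or_one i with e | e
    · exact Or.inr (Or.inr (Or.inr (Or.inr (Or.inr (Or.inr (Or.inl ⟨h', e', e, by omega, by omega⟩))))))
    · exact Or.inr (Or.inr (Or.inr (Or.inr (Or.inr (Or.inr (Or.inr (⟨h', e', e, by omega, by omega⟩)))))))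
    · exact Or.inr (Or.inr (Or.inr (Or.inr (Or.inr (Or.inl ⟨h', e', e, by omega, by omega⟩)))))
    · exact Or.inr (Or.inr (Or.inr (Or.inr (Or.inl ⟨h', e', e, by omega, by omega⟩))))

theorem sys0_ncU (h1 : 1 ≤ k1) (i j : ℕ) (hi : i < A) (hj : j < A) (e : i % 2 = j % 2) :
    NC (U0 A k1 i) (U0 A k1 (i+1)) (U0 A k1 j) (U0 A k1 (j+1)) := by
  have a1 := U0_crease (A := A) (k1 := k1) i
  have a2 := U0_crease (A := A) (k1 := k1) j
  generalize U0 A k1 i = x at *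
  generalize U0 A k1 (i+1) = y at *
  generalize U0 A k1 j = z at *
  generalize U0 A k1 (j+1) = w at *
  unfold NC
  rcases a1 with a1 | a1 | a1 | a1 | a1 | a1 | a1 | a1 <;>
  rcases a2 with a2 | a2 | a2 | a2 | a2 | a2 | a2 | a2 <;> omega

set_option maxHeartbeats 4000000 in
theorem sys0_ncV (h1 : 1 ≤ k1) (h2 : k1 ≤ A) (h3 : k1 ≤ k2) (i j : ℕ) (hi : i < B) (hj : j < B)
    (e : i % 2 = j % 2) :
    NC (V0 A B k1 k2 i) (V0 A B k1 k2 (i+1)) (V0 A B k1 k2 j) (V0 A B k1 k2 (j+1)) := by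
  obtain ⟨p, q, b1, b2, a1⟩ := V0_crease (A := A) (B := B) h3 i
  obtain ⟨p', q', b1', b2', a2⟩ := V0_crease (A := A) (B := B) h3 j
  generalize V0 A B k1 k2 i = x at *
  generalize V0 A B k1 k2 (i+1) = y at *
  generalize V0 A B k1 k2 j = z at *
  generalize V0 A B k1 k2 (j+1) = w at *
  unfold NC
  rcases a1 with a1 | a1 | a1 | a1 | a1 | a1 | a1 | a1 <;>
  rcases a2 with a2 | a2 | a2 | a2 | a2 | a2 | a2 | a2 <;> omega

set_option maxHeartbeats 4000000 in
theorem sys0_ncUV (h1 : 1 ≤ k1) (h2 : k1 ≤ A) (h3 : k1 ≤ k2) (i j : ℕ) (hi : i < A) (hj : j < B)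
    (e : i % 2 ≠ j % 2) :
    NC (U0 A k1 i) (U0 A k1 (i+1)) (V0 A B k1 k2 j) (V0 A B k1 k2 (j+1)) := by
  have a1 := U0_crease (A := A) (k1 := k1) i
  obtain ⟨p', q', b1', b2', a2⟩ := V0_crease (A := A) (B := B) h3 j
  generalize U0 A k1 i = x at *
  generalize U0 A k1 (i+1) = y at *
  generalize V0 A B k1 k2 j = z at *
  generalize V0 A B k1 k2 (j+1) = w at *
  unfold NC
  rcases a1 with a1 | a1 | a1 | a1 | a1 | a1 | a1 | a1 <;>
  rcases a2 with a2 | a2 | a2 | a2 | a2 | a2 | a2 | a2 <;> omega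

theorem sys0_injU (h1 : 1 ≤ k1) (i j : ℕ) (hi : i ≤ A) (hj : j ≤ A) (e : i < j) :
    U0 A k1 i ≠ U0 A k1 j := by
  have a1 := U0_val (A := A) (k1 := k1) i
  have a3 := U0_val (A := A) (k1 := k1) j
  generalize U0 A k1 i = x at *
  generalize U0 A k1 j = z at *
  rcases a1 with ⟨g1, a1 | a1⟩ | ⟨g1, a1 | a1 | a1 | a1⟩ <;> omega

theorem sys0_injV (h1 : 1 ≤ k1) (h2 : k1 ≤ A) (h3 : k1 ≤ k2) (i j : ℕ) (hi : i ≤ B) (hj : j ≤ B)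
    (e : i < j) : V0 A B k1 k2 i ≠ V0 A B k1 k2 j := by
  have a1 := V0_val (A := A) (B := B) h3 i
  have a3 := V0_val (A := A) (B := B) h3 j
  generalize V0 A B k1 k2 i = x at *
  generalize V0 A B k1 k2 j = z at *
  rcases a1 with ⟨g1, g1', a1 | a1⟩ | ⟨g1, g1', a1 | a1⟩ | ⟨g1, a1 | a1 | a1 | a1⟩ <;> omega

theorem sys0_injUV (h1 : 1 ≤ k1) (h2 : k1 ≤ A) (h3 : k1 ≤ k2) (i j : ℕ) (hi : i ≤ A) (hj : j ≤ B)
    (e : 1 ≤ i + j) : U0 A k1 i ≠ V0 A B k1 k2 j := by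
  have a1 := U0_val (A := A) (k1 := k1) i
  have a3 := V0_val (A := A) (B := B) h3 j
  generalize U0 A k1 i = x at *
  generalize V0 A B k1 k2 j = z at *
  rcases a1 with ⟨g1, a1 | a1⟩ | ⟨g1, a1 | a1 | a1 | a1⟩ <;> omega

theorem sys0 (h1 : 1 ≤ k1) (h2 : k1 ≤ A) (h3 : k1 ≤ k2) :
    Sys A B (U0 A k1) (V0 A B k1 k2) := by
  refine mkSys ?_ ?_ ?_ (sys0_ncU h1) (sys0_ncV h1 h2 h3) (sys0_ncUV h1 h2 h3)
    (sys0_injU h1) (sys0_injV h1 h2 h3) (sys0_injUV h1 h2 h3)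
  · simp [U0, V0, sg, show 0 < k1 by omega]
  · intro i hi
    have a1 := U0_crease (A := A) (k1 := k1) i
    rcases a1 with a1 | a1 | a1 | a1 | a1 | a1 | a1 | a1 <;> omega
  · intro i hi
    obtain ⟨p, q, b1, b2, a1⟩ := V0_crease (A := A) (B := B) h3 i
    rcases a1 with a1 | a1 | a1 | a1 | a1 | a1 | a1 | a1 <;> omega

theorem spineU0 (h1 : 1 ≤ k1) (h2 : k1 ≤ A) : Spine A (U0 A k1) k1 := by
  refine ⟨h1, h2, ?_, ?_⟩
  · intro k hk hk1
    have a1 := U0_val (A := A) (k1 := k1) (k-1)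
    have a2 := U0_val (A := A) (k1 := k1) (k+1)
    unfold Out
    omega
  · intro hlt
    have a1 := U0_val (A := A) (k1 := k1) (k1-1)
    have a2 := U0_val (A := A) (k1 := k1) (k1+1)
    unfold Out
    omega

theorem spineV0 (h1 : 1 ≤ k1) (h2 : k1 ≤ A) (h3 : k1 ≤ k2) (h4 : k2 ≤ B) :
    Spine B (ng (V0 A B k1 k2)) k2 := by
  refine ⟨by omega, h4, ?_, ?_⟩
  · intro k hk hk1
    have a1 := V0_val (A := A) (B := B) h3 (k-1)
    have a2 := V0_val (A := A) (B := B) h3 (k+1)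
    unfold Out ng
    omega
  · intro hlt
    have a1 := V0_val (A := A) (B := B) h3 (k2-1)
    have a2 := V0_val (A := A) (B := B) h3 (k2+1)
    unfold Out ng
    omega

theorem tc0 (h1 : 1 ≤ k1) (h2 : k1 ≤ A) (h3 : k1 ≤ k2) (h4 : k2 ≤ B) (hBA : B ≤ A + 1) :
    TC B (U0 A k1) (V0 A B k1 k2) k1 k2 0 := by
  refine ⟨fun e => ⟨by omega, ?_, ?_⟩, fun _ => rfl⟩
  · intro j hj
    obtain rfl : j = 0 := by omega
    exact acc_zero (sys0 h1 h2 h3) (spineU0 h1 h2) (spineV0 h1 h2 h3 h4) e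
  · intro hlt
    have a1 := U0_val (A := A) (k1 := k1) (k1+(0+1))
    have a2 := V0_val (A := A) (B := B) h3 (k2+(0+1))
    unfold Acc
    omega

end sep


theorem NC.sg {x y z w : ℤ} (k : ℕ) (h : NC x y z w) :
    NC (sg k x) (sg k y) (sg k z) (sg k w) := by
  unfold Stamp.sg
  split_ifs
  · exact h
  · exact h.neg


theorem mkSys' {A B : ℕ} {u v : ℕ → ℤ} (h0 : u 0 = v 0)
    (mvU : ∀ i, i < A → (i % 2 = 0 → u (i+1) < u i) ∧ (i % 2 = 1 → u i < u (i+1)))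
    (mvV : ∀ i, i < B → (i % 2 = 0 → v i < v (i+1)) ∧ (i % 2 = 1 → v (i+1) < v i))
    (ncU : ∀ i j, i < A → j < A → i < j → i % 2 = j % 2 → NC (u i) (u (i+1)) (u j) (u (j+1)))
    (ncV : ∀ i j, i < B → j < B → i < j → i % 2 = j % 2 → NC (v i) (v (i+1)) (v j) (v (j+1)))
    (ncUV : ∀ i j, i < A → j < B → i % 2 ≠ j % 2 → NC (u i) (u (i+1)) (v j) (v (j+1)))
    (injU : ∀ i j, i ≤ A → j ≤ A → i < j → u i ≠ u j)
    (injV : ∀ i j, i ≤ B → j ≤ B → i < j → v i ≠ v j)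
    (injUV : ∀ i j, i ≤ A → j ≤ B → 1 ≤ i + j → u i ≠ v j) : Sys A B u v := by
  refine mkSys h0 mvU mvV ?_ ?_ ncUV injU injV injUV
  · intro i j hi hj e
    rcases lt_trichotomy i j with h | rfl | h
    · exact ncU i j hi hj h e
    · unfold NC; omega
    · exact (ncU j i hj hi h e.symm).symm' (injU _ _ (by omega) (by omega) (by omega))
        (injU _ _ (by omega) (by omega) (by omega)) (injU _ _ (by omega) (by omega) (by omega))
        (injU _ _ (by omega) (by omega) (by omega))
  · intro i j hi hj e
    rcases lt_trichotomy i j with h | rfl | h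
    · exact ncV i j hi hj h e
    · unfold NC; omega
    · exact (ncV j i hj hi h e.symm).symm' (injV _ _ (by omega) (by omega) (by omega))
        (injV _ _ (by omega) (by omega) (by omega)) (injV _ _ (by omega) (by omega) (by omega))
        (injV _ _ (by omega) (by omega) (by omega))

/-- Interleaved-curl model, up to the global sign `sg k1`. -/
def U1 (A k1 t g : ℕ) (k : ℕ) : ℤ :=
  if k < k1 then (if (k + k1) % 2 = 0 then (k : ℤ) else -k)
  else if (k + k1) % 2 = 0 then
    k1 + 2 * (A - k1) + 2 * g + 3 + (2 * (A - k) + 1 + if k < k1 + t then 2 * (g : ℤ) else 0)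
  else
    k1 + 2 * (A - k1) + 2 * g + 3 - (2 * (A - k) + 1 + if k < k1 + t then 2 * (g : ℤ) else 0)

def V1 (A k1 t g : ℕ) (l : ℕ) : ℤ :=
  if l ≤ k1 then (if (l + k1) % 2 = 0 then -(l : ℤ) else l)
  else if l < k1 + 1 + t then
    (if (l + k1) % 2 = 1 then k1 + 2 * (A - k1) + 2 * g + 3 + (2 * (A - l) + 4 + 2 * g)
     else k1 + 2 * (A - k1) + 2 * g + 3 - (2 * (A - l) + 4 + 2 * g))
  else if t % 2 = 0 then
    (if (l + k1) % 2 = 1 then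
      k1 + 2 * (A - k1) + 2 * g + 3 + (2 * (A - k1 - t) + 1 + 2 * g - (l - k1 - 1 - t))
    else k1 + 2 * (A - k1) + 2 * g + 3 + (2 * (A - k1 - t) + 1 + (l - k1 - 1 - t)))
  else
    (if (l + k1) % 2 = 0 then
      k1 + 2 * (A - k1) + 2 * g + 3 - (2 * (A - k1 - t) + 1 + 2 * g - (l - k1 - 1 - t))
    else k1 + 2 * (A - k1) + 2 * g + 3 - (2 * (A - k1 - t) + 1 + (l - k1 - 1 - t)))

section inter
variable {A k1 t g : ℕ}

theorem U1_val {C : ℤ} (hC : C = k1 + 2 * (A - k1) + 2 * g + 3) (k : ℕ) :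
    ∃ r : ℤ, ((k < k1 + t ∧ r = 2 * (A - k) + 1 + 2 * g) ∨ (k1 + t ≤ k ∧ r = 2 * (A - k) + 1)) ∧
    ((k < k1 ∧ (k + k1) % 2 = 0 ∧ U1 A k1 t g k = k) ∨
     (k < k1 ∧ (k + k1) % 2 = 1 ∧ U1 A k1 t g k = -k) ∨
     (k1 ≤ k ∧ (k + k1) % 2 = 0 ∧ U1 A k1 t g k = C + r) ∨
     (k1 ≤ k ∧ (k + k1) % 2 = 1 ∧ U1 A k1 t g k = C - r)) := by
  refine ⟨2 * (A - k) + 1 + if k < k1 + t then 2 * (g : ℤ) else 0, ?_, ?_⟩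
  · split_ifs <;> omega
  · unfold U1
    rw [← hC]
    rcases Nat.lt_or_ge k k1 with h | h <;> rcases Nat.mod_two_eq_zero_or_one (k + k1) with e | e
    · exact Or.inl ⟨h, e, by rw [if_pos h, if_pos e]⟩
    · exact Or.inr (Or.inl ⟨h, e, by rw [if_pos h, if_neg (by omega)]⟩)
    · exact Or.inr (Or.inr (Or.inl ⟨h, e, by rw [if_neg (by omega), if_pos e]⟩))
    · exact Or.inr (Or.inr (Or.inr ⟨h, e, by rw [if_neg (by omega), if_neg (by omega)]⟩))

theorem V1_val {C R : ℤ} (hC : C = k1 + 2 * (A - k1) + 2 * g + 3)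
    (hR : R = 2 * (A - k1 - t) + 1) (l : ℕ) :
    (l ≤ k1 ∧ (l + k1) % 2 = 0 ∧ V1 A k1 t g l = -l) ∨
    (l ≤ k1 ∧ (l + k1) % 2 = 1 ∧ V1 A k1 t g l = l) ∨
    (k1 < l ∧ l < k1 + 1 + t ∧ (l + k1) % 2 = 1 ∧ V1 A k1 t g l = C + (2 * (A - l) + 4 + 2 * g)) ∨
    (k1 < l ∧ l < k1 + 1 + t ∧ (l + k1) % 2 = 0 ∧ V1 A k1 t g l = C - (2 * (A - l) + 4 + 2 * g)) ∨
    (k1 + 1 + t ≤ l ∧ t % 2 = 0 ∧ (l + k1) % 2 = 1 ∧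
      V1 A k1 t g l = C + (R + 2 * g - (l - k1 - 1 - t))) ∨
    (k1 + 1 + t ≤ l ∧ t % 2 = 0 ∧ (l + k1) % 2 = 0 ∧
      V1 A k1 t g l = C + (R + (l - k1 - 1 - t))) ∨
    (k1 + 1 + t ≤ l ∧ t % 2 = 1 ∧ (l + k1) % 2 = 0 ∧
      V1 A k1 t g l = C - (R + 2 * g - (l - k1 - 1 - t))) ∨
    (k1 + 1 + t ≤ l ∧ t % 2 = 1 ∧ (l + k1) % 2 = 1 ∧
      V1 A k1 t g l = C - (R + (l - k1 - 1 - t))) := by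
  unfold V1
  rw [← hC, ← hR]
  rcases Nat.mod_two_eq_zero_or_one (l + k1) with e | e
  all_goals
    rcases Nat.lt_or_ge k1 l with h | h
    · rcases Nat.lt_or_ge l (k1 + 1 + t) with h' | h'
      · simp [e, h, h', not_le.mpr h, not_le.mpr h']
      · rcases Nat.mod_two_eq_zero_or_one t with e' | e' <;>
        simp [e, e', h, h', not_le.mpr h, not_lt.mpr h']
    · simp [e, h, not_lt.mpr h]

theorem U1_crease {C : ℤ} (hC : C = k1 + 2 * (A - k1) + 2 * g + 3) (ht : 1 ≤ t) (i : ℕ) :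
    (i + 1 < k1 ∧ (i + k1) % 2 = 0 ∧
      U1 A k1 t g i = i ∧ U1 A k1 t g (i+1) = -(i + 1)) ∨
    (i + 1 < k1 ∧ (i + k1) % 2 = 1 ∧
      U1 A k1 t g i = -i ∧ U1 A k1 t g (i+1) = i + 1) ∨
    (i + 1 = k1 ∧ (i + k1) % 2 = 1 ∧
      U1 A k1 t g i = -i ∧ U1 A k1 t g (i+1) = C + (2 * (A - i) - 1 + 2 * g)) ∨
    (k1 ≤ i ∧ i + 1 < k1 + t ∧ (i + k1) % 2 = 0 ∧
      U1 A k1 t g i = C + (2 * (A - i) + 1 + 2 * g) ∧ U1 A k1 t g (i+1) = C - (2 * (A - i) - 1 + 2 * g)) ∨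
    (k1 ≤ i ∧ i + 1 < k1 + t ∧ (i + k1) % 2 = 1 ∧
      U1 A k1 t g i = C - (2 * (A - i) + 1 + 2 * g) ∧ U1 A k1 t g (i+1) = C + (2 * (A - i) - 1 + 2 * g)) ∨
    (k1 ≤ i ∧ i + 1 = k1 + t ∧ (i + k1) % 2 = 0 ∧
      U1 A k1 t g i = C + (2 * (A - i) + 1 + 2 * g) ∧ U1 A k1 t g (i+1) = C - (2 * (A - i) - 1)) ∨
    (k1 ≤ i ∧ i + 1 = k1 + t ∧ (i + k1) % 2 = 1 ∧
      U1 A k1 t g i = C - (2 * (A - i) + 1 + 2 * g) ∧ U1 A k1 t g (i+1) = C + (2 * (A - i) - 1)) ∨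
    (k1 + t ≤ i ∧ (i + k1) % 2 = 0 ∧
      U1 A k1 t g i = C + (2 * (A - i) + 1) ∧ U1 A k1 t g (i+1) = C - (2 * (A - i) - 1)) ∨
    (k1 + t ≤ i ∧ (i + k1) % 2 = 1 ∧
      U1 A k1 t g i = C - (2 * (A - i) + 1) ∧ U1 A k1 t g (i+1) = C + (2 * (A - i) - 1)) := by
  obtain ⟨r, hr, a1⟩ := U1_val (t := t) hC i
  obtain ⟨s, hs, a2⟩ := U1_val (t := t) hC (i+1)
  push_cast at hs
  generalize U1 A k1 t g i = x at *
  generalize U1 A k1 t g (i+1) = y at *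
  clear hC
  rcases lt_trichotomy (i+1) k1 with h | h | h
  · rcases Nat.mod_two_eq_zero_or_one (i + k1) with e | e
    · exact Or.inl ⟨h, e, by omega, by omega⟩
    · exact Or.inr (Or.inl ⟨h, e, by omega, by omega⟩)
  · have e : (i + k1) % 2 = 1 := by omega
    exact Or.inr (Or.inr (Or.inl ⟨h, e, by omega, by omega⟩))
  · have h' : k1 ≤ i := by omega
    rcases lt_trichotomy (i+1) (k1+t) with f | f | f <;>
    rcases Nat.mod_two_eq_zero_or_one (i + k1) with e | e
    · exact Or.inr (Or.inr (Or.inr (Or.inl ⟨h', f, e, by omega, by omega⟩)))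
    · exact Or.inr (Or.inr (Or.inr (Or.inr (Or.inl ⟨h', f, e, by omega, by omega⟩))))
    · exact Or.inr (Or.inr (Or.inr (Or.inr (Or.inr (Or.inl ⟨h', f, e, by omega, by omega⟩)))))
    · exact Or.inr (Or.inr (Or.inr (Or.inr (Or.inr (Or.inr (Or.inl ⟨h', f, e, by omega, by omega⟩))))))
    · exact Or.inr (Or.inr (Or.inr (Or.inr (Or.inr (Or.inr (Or.inr (Or.inl ⟨by omega, e, by omega, by omega⟩)))))))
    · exact Or.inr (Or.inr (Or.inr (Or.inr (Or.inr (Or.inr (Or.inr (Or.inr (⟨by omega, e, by omega, by omega⟩))))))))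

theorem V1_crease {C R : ℤ} (hC : C = k1 + 2 * (A - k1) + 2 * g + 3)
    (hR : R = 2 * (A - k1 - t) + 1) (ht : 1 ≤ t) (i : ℕ) :
    (i < k1 ∧ (i + k1) % 2 = 0 ∧ V1 A k1 t g i = -i ∧ V1 A k1 t g (i+1) = i + 1) ∨
    (i < k1 ∧ (i + k1) % 2 = 1 ∧ V1 A k1 t g i = i ∧ V1 A k1 t g (i+1) = -(i + 1)) ∨
    (i = k1 ∧ (i + k1) % 2 = 0 ∧ V1 A k1 t g i = -i ∧
      V1 A k1 t g (i+1) = C + (2 * (A - i) + 2 + 2 * g)) ∨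
    (k1 < i ∧ i < k1 + t ∧ (i + k1) % 2 = 1 ∧ V1 A k1 t g i = C + (2 * (A - i) + 4 + 2 * g) ∧
      V1 A k1 t g (i+1) = C - (2 * (A - i) + 2 + 2 * g)) ∨
    (k1 < i ∧ i < k1 + t ∧ (i + k1) % 2 = 0 ∧ V1 A k1 t g i = C - (2 * (A - i) + 4 + 2 * g) ∧
      V1 A k1 t g (i+1) = C + (2 * (A - i) + 2 + 2 * g)) ∨
    (i = k1 + t ∧ t % 2 = 1 ∧ (i + k1) % 2 = 1 ∧ V1 A k1 t g i = C + (2 * (A - i) + 4 + 2 * g) ∧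
      V1 A k1 t g (i+1) = C - (R + 2 * g)) ∨
    (i = k1 + t ∧ t % 2 = 0 ∧ (i + k1) % 2 = 0 ∧ V1 A k1 t g i = C - (2 * (A - i) + 4 + 2 * g) ∧
      V1 A k1 t g (i+1) = C + (R + 2 * g)) ∨
    (k1 + t < i ∧ t % 2 = 0 ∧ (i + k1) % 2 = 1 ∧
      V1 A k1 t g i = C + (R + 2 * g - (i - k1 - 1 - t)) ∧
      V1 A k1 t g (i+1) = C + (R + (i - k1 - t))) ∨
    (k1 + t < i ∧ t % 2 = 0 ∧ (i + k1) % 2 = 0 ∧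
      V1 A k1 t g i = C + (R + (i - k1 - 1 - t)) ∧
      V1 A k1 t g (i+1) = C + (R + 2 * g - (i - k1 - t))) ∨
    (k1 + t < i ∧ t % 2 = 1 ∧ (i + k1) % 2 = 0 ∧
      V1 A k1 t g i = C - (R + 2 * g - (i - k1 - 1 - t)) ∧
      V1 A k1 t g (i+1) = C - (R + (i - k1 - t))) ∨
    (k1 + t < i ∧ t % 2 = 1 ∧ (i + k1) % 2 = 1 ∧
      V1 A k1 t g i = C - (R + (i - k1 - 1 - t)) ∧
      V1 A k1 t g (i+1) = C - (R + 2 * g - (i - k1 - t))) := by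
  have a1 := V1_val (t := t) hC hR i
  have a2 := V1_val (t := t) hC hR (i+1)
  push_cast at a2
  generalize V1 A k1 t g i = x at *
  generalize V1 A k1 t g (i+1) = y at *
  clear hC hR
  rcases lt_trichotomy i k1 with h | h | h
  · rcases Nat.mod_two_eq_zero_or_one (i + k1) with e | e
    · exact Or.inl ⟨h, e, by omega, by omega⟩
    · exact Or.inr (Or.inl ⟨h, e, by omega, by omega⟩)
  · have e : (i + k1) % 2 = 0 := by omega
    exact Or.inr (Or.inr (Or.inl ⟨h, e, by omega, by omega⟩))
  · rcases lt_trichotomy i (k1 + t) with h' | h' | h'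
    · rcases Nat.mod_two_eq_zero_or_one (i + k1) with e | e
      · exact Or.inr (Or.inr (Or.inr (Or.inr (Or.inl ⟨h, h', e, by omega, by omega⟩))))
      · exact Or.inr (Or.inr (Or.inr (Or.inl ⟨h, h', e, by omega, by omega⟩)))
    · rcases Nat.mod_two_eq_zero_or_one t with f | f
      · have e : (i + k1) % 2 = 0 := by omega
        exact Or.inr (Or.inr (Or.inr (Or.inr (Or.inr (Or.inr (Or.inl ⟨h', f, e, by omega, by omega⟩))))))
      · have e : (i + k1) % 2 = 1 := by omega
        exact Or.inr (Or.inr (Or.inr (Or.inr (Or.inr (Or.inl ⟨h', f, e, by omega, by omega⟩)))))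
    · rcases Nat.mod_two_eq_zero_or_one t with f | f <;>
      rcases Nat.mod_two_eq_zero_or_one (i + k1) with e | e
      · exact Or.inr (Or.inr (Or.inr (Or.inr (Or.inr (Or.inr (Or.inr (Or.inr (Or.inl ⟨h', f, e, by omega, by omega⟩))))))))
      · exact Or.inr (Or.inr (Or.inr (Or.inr (Or.inr (Or.inr (Or.inr (Or.inl ⟨h', f, e, by omega, by omega⟩)))))))
      · exact Or.inr (Or.inr (Or.inr (Or.inr (Or.inr (Or.inr (Or.inr (Or.inr (Or.inr (Or.inl ⟨h', f, e, by omega, by omega⟩)))))))))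
      · exact Or.inr (Or.inr (Or.inr (Or.inr (Or.inr (Or.inr (Or.inr (Or.inr (Or.inr (Or.inr (⟨h', f, e, by omega, by omega⟩))))))))))

theorem NC_lt {x y z w : ℤ} (h : x < y) : NC x y z w ↔ ((x < z ∧ z < y) ↔ (x < w ∧ w < y)) := by
  unfold NC; constructor <;> intro h' <;> omega

theorem NC_gt {x y z w : ℤ} (h : y < x) : NC x y z w ↔ ((y < z ∧ z < x) ↔ (y < w ∧ w < x)) := by
  unfold NC; constructor <;> intro h' <;> omega

set_option maxHeartbeats 4000000 in
theorem sys1_ncU (hA : k1 + t + g ≤ A + 1) (ht : 1 ≤ t) (hg : 1 ≤ g) (i j : ℕ) (hi : i < A) (hj : j < A)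
    (hij : i < j) (e : i % 2 = j % 2) :
    NC (U1 A k1 t g i) (U1 A k1 t g (i+1)) (U1 A k1 t g j) (U1 A k1 t g (j+1)) := by
  obtain ⟨C, hC⟩ : ∃ C : ℤ, C = k1 + 2 * (A - k1) + 2 * g + 3 := ⟨_, rfl⟩
  have a1 := U1_crease hC ht i
  have a2 := U1_crease hC ht j
  generalize U1 A k1 t g i = x at *
  generalize U1 A k1 t g (i+1) = y at *
  generalize U1 A k1 t g j = z at *
  generalize U1 A k1 t g (j+1) = w at *
  rcases a1 with a1 | a1 | a1 | a1 | a1 | a1 | a1 | a1 | a1 <;>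
  rcases a2 with a2 | a2 | a2 | a2 | a2 | a2 | a2 | a2 | a2 <;>
  first
  | (exfalso; omega)
  | (rw [NC_lt (by omega)]; constructor <;> intro h <;> constructor <;> omega)
  | (rw [NC_gt (by omega)]; constructor <;> intro h <;> constructor <;> omega)

set_option maxHeartbeats 4000000 in
theorem sys1_ncV (hA : k1 + t + g ≤ A + 1) (ht : 1 ≤ t) (hg : 1 ≤ g) (i j : ℕ)
    (hi : i < k1 + t + g) (hj : j < k1 + t + g) (hij : i < j) (e : i % 2 = j % 2) :
    NC (V1 A k1 t g i) (V1 A k1 t g (i+1)) (V1 A k1 t g j) (V1 A k1 t g (j+1)) := by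
  obtain ⟨C, hC⟩ : ∃ C : ℤ, C = k1 + 2 * (A - k1) + 2 * g + 3 := ⟨_, rfl⟩
  obtain ⟨R, hR⟩ : ∃ R : ℤ, R = 2 * (A - k1 - t) + 1 := ⟨_, rfl⟩
  have a1 := V1_crease hC hR ht i
  have a2 := V1_crease hC hR ht j
  generalize V1 A k1 t g i = x at *
  generalize V1 A k1 t g (i+1) = y at *
  generalize V1 A k1 t g j = z at *
  generalize V1 A k1 t g (j+1) = w at *
  rcases a1 with a1 | a1 | a1 | a1 | a1 | a1 | a1 | a1 | a1 | a1 | a1 <;>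
  rcases a2 with a2 | a2 | a2 | a2 | a2 | a2 | a2 | a2 | a2 | a2 | a2 <;>
  first
  | (exfalso; omega)
  | (rw [NC_lt (by omega)]; constructor <;> intro h <;> constructor <;> omega)
  | (rw [NC_gt (by omega)]; constructor <;> intro h <;> constructor <;> omega)

set_option maxHeartbeats 4000000 in
theorem sys1_ncUV (hA : k1 + t + g ≤ A + 1) (ht : 1 ≤ t) (hg : 1 ≤ g) (i j : ℕ)
    (hi : i < A) (hj : j < k1 + t + g) (e : i % 2 ≠ j % 2) :
    NC (U1 A k1 t g i) (U1 A k1 t g (i+1)) (V1 A k1 t g j) (V1 A k1 t g (j+1)) := by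
  replace e : (i + j) % 2 = 1 := by omega
  obtain ⟨C, hC⟩ : ∃ C : ℤ, C = k1 + 2 * (A - k1) + 2 * g + 3 := ⟨_, rfl⟩
  obtain ⟨R, hR⟩ : ∃ R : ℤ, R = 2 * (A - k1 - t) + 1 := ⟨_, rfl⟩
  have a1 := U1_crease hC ht i
  have a2 := V1_crease hC hR ht j
  generalize U1 A k1 t g i = x at *
  generalize U1 A k1 t g (i+1) = y at *
  generalize V1 A k1 t g j = z at *
  generalize V1 A k1 t g (j+1) = w at *
  rcases a1 with a1 | a1 | a1 | a1 | a1 | a1 | a1 | a1 | a1 <;>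
  rcases a2 with a2 | a2 | a2 | a2 | a2 | a2 | a2 | a2 | a2 | a2 | a2 <;>
  first
  | (exfalso; omega)
  | (rw [NC_lt (by omega)]; constructor <;> intro h <;> constructor <;> omega)
  | (rw [NC_gt (by omega)]; constructor <;> intro h <;> constructor <;> omega)

set_option maxHeartbeats 4000000 in
theorem sys1_injU (hA : k1 + t + g ≤ A + 1) (i j : ℕ) (hi : i ≤ A) (hj : j ≤ A) (e : i < j) :
    U1 A k1 t g i ≠ U1 A k1 t g j := by
  obtain ⟨C, hC⟩ : ∃ C : ℤ, C = k1 + 2 * (A - k1) + 2 * g + 3 := ⟨_, rfl⟩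
  obtain ⟨r, hr, a1⟩ := U1_val (t := t) hC i
  obtain ⟨s, hs, a2⟩ := U1_val (t := t) hC j
  generalize U1 A k1 t g i = x at *
  generalize U1 A k1 t g j = z at *
  rcases a1 with a1 | a1 | a1 | a1 <;> rcases a2 with a2 | a2 | a2 | a2 <;> omega

set_option maxHeartbeats 4000000 in
theorem sys1_injV (hA : k1 + t + g ≤ A + 1) (i j : ℕ) (hi : i ≤ k1 + t + g)
    (hj : j ≤ k1 + t + g) (e : i < j) : V1 A k1 t g i ≠ V1 A k1 t g j := by
  obtain ⟨C, hC⟩ : ∃ C : ℤ, C = k1 + 2 * (A - k1) + 2 * g + 3 := ⟨_, rfl⟩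
  obtain ⟨R, hR⟩ : ∃ R : ℤ, R = 2 * (A - k1 - t) + 1 := ⟨_, rfl⟩
  have a1 := V1_val (t := t) hC hR i
  have a2 := V1_val (t := t) hC hR j
  generalize V1 A k1 t g i = x at *
  generalize V1 A k1 t g j = z at *
  rcases a1 with a1 | a1 | a1 | a1 | a1 | a1 | a1 | a1 <;>
  rcases a2 with a2 | a2 | a2 | a2 | a2 | a2 | a2 | a2 <;> omega

set_option maxHeartbeats 4000000 in
theorem sys1_injUV (hA : k1 + t + g ≤ A + 1) (hk : 1 ≤ k1) (hg : 1 ≤ g) (i j : ℕ) (hi : i ≤ A)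
    (hj : j ≤ k1 + t + g) (e : 1 ≤ i + j) : U1 A k1 t g i ≠ V1 A k1 t g j := by
  obtain ⟨C, hC⟩ : ∃ C : ℤ, C = k1 + 2 * (A - k1) + 2 * g + 3 := ⟨_, rfl⟩
  obtain ⟨R, hR⟩ : ∃ R : ℤ, R = 2 * (A - k1 - t) + 1 := ⟨_, rfl⟩
  obtain ⟨r, hr, a1⟩ := U1_val (t := t) hC i
  have a2 := V1_val (t := t) hC hR j
  generalize U1 A k1 t g i = x at *
  generalize V1 A k1 t g j = z at *
  rcases a1 with a1 | a1 | a1 | a1 <;>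
  rcases a2 with a2 | a2 | a2 | a2 | a2 | a2 | a2 | a2 <;> omega

theorem sg_inj {k : ℕ} {x y : ℤ} (h : x ≠ y) : sg k x ≠ sg k y := by
  unfold sg; split_ifs <;> omega

theorem sg_cases (k : ℕ) (x : ℤ) : (k % 2 = 0 ∧ sg k x = x) ∨ (k % 2 = 1 ∧ sg k x = -x) := by
  unfold sg; split_ifs <;> omega

theorem sys1 (hA : k1 + t + g ≤ A + 1) (hk : 1 ≤ k1) (ht : 1 ≤ t) (hg : 1 ≤ g) :
    Sys A (k1 + t + g) (fun k => sg k1 (U1 A k1 t g k)) (fun k => sg k1 (V1 A k1 t g k)) := by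
  obtain ⟨C, hC⟩ : ∃ C : ℤ, C = k1 + 2 * (A - k1) + 2 * g + 3 := ⟨_, rfl⟩
  obtain ⟨R, hR⟩ : ∃ R : ℤ, R = 2 * (A - k1 - t) + 1 := ⟨_, rfl⟩
  refine mkSys' ?_ ?_ ?_ (fun i j hi hj hij e => (sys1_ncU hA ht hg i j hi hj hij e).sg k1)
    (fun i j hi hj hij e => (sys1_ncV hA ht hg i j hi hj hij e).sg k1)
    (fun i j hi hj e => (sys1_ncUV hA ht hg i j hi hj e).sg k1)
    (fun i j hi hj e => sg_inj (sys1_injU hA i j hi hj e))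
    (fun i j hi hj e => sg_inj (sys1_injV hA i j hi hj e))
    (fun i j hi hj e => sg_inj (sys1_injUV hA hk hg i j hi hj e))
  · have : U1 A k1 t g 0 = V1 A k1 t g 0 := by
      simp [U1, V1, show 0 < k1 by omega]
    simp [this]
  · intro i hi
    have a1 := U1_crease hC ht i
    have c1 := sg_cases k1 (U1 A k1 t g i)
    have c2 := sg_cases k1 (U1 A k1 t g (i+1))
    beta_reduce
    rcases a1 with a1 | a1 | a1 | a1 | a1 | a1 | a1 | a1 | a1 <;> omega
  · intro i hi
    have a1 := V1_crease hC hR ht i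
    have c1 := sg_cases k1 (V1 A k1 t g i)
    have c2 := sg_cases k1 (V1 A k1 t g (i+1))
    beta_reduce
    rcases a1 with a1 | a1 | a1 | a1 | a1 | a1 | a1 | a1 | a1 | a1 | a1 <;> omega

theorem spineU1 (hA : k1 + t + g ≤ A + 1) (hk : 1 ≤ k1) (ht : 1 ≤ t) (hg : 1 ≤ g) :
    Spine A (fun k => sg k1 (U1 A k1 t g k)) k1 := by
  obtain ⟨C, hC⟩ : ∃ C : ℤ, C = k1 + 2 * (A - k1) + 2 * g + 3 := ⟨_, rfl⟩
  refine ⟨hk, by omega, ?_, ?_⟩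
  · intro k h1 h2
    obtain ⟨r, hr, a1⟩ := U1_val (t := t) hC (k-1)
    obtain ⟨s, hs, a2⟩ := U1_val (t := t) hC (k+1)
    have c1 := sg_cases k1 (U1 A k1 t g (k-1))
    have c2 := sg_cases k1 (U1 A k1 t g (k+1))
    simp only [Out]
    rcases a1 with a1 | a1 | a1 | a1 <;> rcases a2 with a2 | a2 | a2 | a2 <;> omega
  · intro hlt
    obtain ⟨r, hr, a1⟩ := U1_val (t := t) hC (k1-1)
    obtain ⟨s, hs, a2⟩ := U1_val (t := t) hC (k1+1)
    have c1 := sg_cases k1 (U1 A k1 t g (k1-1))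
    have c2 := sg_cases k1 (U1 A k1 t g (k1+1))
    simp only [Out]
    rcases a1 with a1 | a1 | a1 | a1 <;> rcases a2 with a2 | a2 | a2 | a2 <;> omega

theorem spineV1 (hA : k1 + t + g ≤ A + 1) (hk : 1 ≤ k1) (ht : 1 ≤ t) (hg : 1 ≤ g) :
    Spine (k1 + t + g) (ng (fun k => sg k1 (V1 A k1 t g k))) (k1 + 1) := by
  obtain ⟨C, hC⟩ : ∃ C : ℤ, C = k1 + 2 * (A - k1) + 2 * g + 3 := ⟨_, rfl⟩
  obtain ⟨R, hR⟩ : ∃ R : ℤ, R = 2 * (A - k1 - t) + 1 := ⟨_, rfl⟩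
  refine ⟨by omega, by omega, ?_, ?_⟩
  · intro k h1 h2
    have a1 := V1_val (t := t) hC hR (k-1)
    have a2 := V1_val (t := t) hC hR (k+1)
    have c1 := sg_cases k1 (V1 A k1 t g (k-1))
    have c2 := sg_cases k1 (V1 A k1 t g (k+1))
    simp only [Out, ng]
    rcases a1 with a1 | a1 | a1 | a1 | a1 | a1 | a1 | a1 <;> omega
  · intro hlt
    have a1 := V1_val (t := t) hC hR (k1+1-1)
    have a2 := V1_val (t := t) hC hR (k1+1+1)
    have c1 := sg_cases k1 (V1 A k1 t g (k1+1-1))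
    have c2 := sg_cases k1 (V1 A k1 t g (k1+1+1))
    simp only [Out, ng]
    rcases a1 with a1 | a1 | a1 | a1 | a1 | a1 | a1 | a1 <;> omega

theorem tc1 (hA : k1 + t + g ≤ A + 1) (hk : 1 ≤ k1) (ht : 1 ≤ t) (hg : 1 ≤ g) :
    TC (k1 + t + g) (fun k => sg k1 (U1 A k1 t g k)) (fun k => sg k1 (V1 A k1 t g k))
      k1 (k1 + 1) t := by
  obtain ⟨C, hC⟩ : ∃ C : ℤ, C = k1 + 2 * (A - k1) + 2 * g + 3 := ⟨_, rfl⟩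
  obtain ⟨R, hR⟩ : ∃ R : ℤ, R = 2 * (A - k1 - t) + 1 := ⟨_, rfl⟩
  refine ⟨fun _ => ⟨by omega, ?_, ?_⟩, by omega⟩
  · intro j hj
    obtain ⟨r, hr, a1⟩ := U1_val (t := t) hC (k1+j)
    have a2 := V1_val (t := t) hC hR (k1+1+j)
    have c1 := sg_cases k1 (U1 A k1 t g (k1+j))
    have c2 := sg_cases k1 (V1 A k1 t g (k1+1+j))
    simp only [Acc]
    rcases a1 with a1 | a1 | a1 | a1 <;>
    rcases a2 with a2 | a2 | a2 | a2 | a2 | a2 | a2 | a2 <;> omega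
  · intro hlt
    obtain ⟨r, hr, a1⟩ := U1_val (t := t) hC (k1+(t+1))
    have a2 := V1_val (t := t) hC hR (k1+1+(t+1))
    have c1 := sg_cases k1 (U1 A k1 t g (k1+(t+1)))
    have c2 := sg_cases k1 (V1 A k1 t g (k1+1+(t+1)))
    simp only [Acc]
    rcases a1 with a1 | a1 | a1 | a1 <;>
    rcases a2 with a2 | a2 | a2 | a2 | a2 | a2 | a2 | a2 <;> omega

end inter

/-- Admissible parameters. -/
def Par (A B k1 k2 t : ℕ) : Prop :=
  1 ≤ k1 ∧ k1 ≤ A ∧ 1 ≤ k2 ∧ k2 ≤ B ∧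
  (t = 0 ∨ (k2 = k1 + 1 ∧ t + k2 ≤ B) ∨ (k1 = k2 + 1 ∧ t + k1 ≤ A))

theorem exists_model_le {A B k1 k2 t : ℕ} (hBA : B ≤ A + 1) (h : Par A B k1 k2 t) (hk : k1 ≤ k2) :
    ∃ u v, Sys A B u v ∧ Conf A B u v k1 k2 t := by
  obtain ⟨h1, h2, h3, h4, h5⟩ := h
  rcases Nat.eq_zero_or_pos t with rfl | ht
  · exact ⟨_, _, sys0 h1 h2 hk, spineU0 h1 h2, spineV0 h1 h2 hk h4,
      fun _ => tc0 h1 h2 hk h4 hBA, by omega⟩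
  · obtain ⟨rfl, h6⟩ : k2 = k1 + 1 ∧ t + k2 ≤ B := by omega
    obtain ⟨g, rfl⟩ : ∃ g, B = k1 + t + g := ⟨B - (k1 + t), by omega⟩
    exact ⟨_, _, sys1 (by omega) h1 ht (by omega), spineU1 (by omega) h1 ht (by omega),
      spineV1 (by omega) h1 ht (by omega), fun _ => tc1 (by omega) h1 ht (by omega), by omega⟩

theorem exists_model {A B k1 k2 t : ℕ} (hBA : B ≤ A + 1) (hAB : A ≤ B + 1)
    (h : Par A B k1 k2 t) : ∃ u v, Sys A B u v ∧ Conf A B u v k1 k2 t := by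
  rcases Nat.lt_or_ge k2 k1 with hk | hk
  · obtain ⟨u, v, hs, c⟩ := exists_model_le (A := B) (B := A) (k1 := k2) (k2 := k1) (t := t) hAB
      (by unfold Par at *; omega) hk.le
    refine ⟨ng v, ng u, hs.swap, c.s2, ?_, by omega, fun _ => ?_⟩
    · rw [ng_ng]; exact c.s1
    · rw [ng_ng, ng_ng]; exact c.tle hk.le
  · exact exists_model_le hBA h hk

theorem Conf.par {A B k1 k2 t : ℕ} {u v : ℕ → ℤ} (c : Conf A B u v k1 k2 t) :
    Par A B k1 k2 t := by
  refine ⟨c.s1.pos, c.s1.le, c.s2.pos, c.s2.le, ?_⟩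
  rcases Nat.lt_or_ge k2 k1 with hk | hk
  · have tc := c.tgt hk
    by_cases e : k1 = k2 + 1
    · exact Or.inr (Or.inr ⟨e, (tc.adj e).1⟩)
    · exact Or.inl (tc.nadj e)
  · have tc := c.tle hk
    by_cases e : k2 = k1 + 1
    · exact Or.inr (Or.inl ⟨e, (tc.adj e).1⟩)
    · exact Or.inl (tc.nadj e)


/-! ### Transfer along order equivalence -/

structure OrdEq (A B : ℕ) (u v u' v' : ℕ → ℤ) : Prop where
  uu : ∀ i j, i ≤ A → j ≤ A → (u i < u j ↔ u' i < u' j)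
  vv : ∀ i j, i ≤ B → j ≤ B → (v i < v j ↔ v' i < v' j)
  uv : ∀ i j, i ≤ A → j ≤ B → (u i < v j ↔ u' i < v' j)
  vu : ∀ i j, i ≤ A → j ≤ B → (v j < u i ↔ v' j < u' i)

section ord
variable {A B : ℕ} {u v u' v' : ℕ → ℤ}

theorem OrdEq.swap (o : OrdEq A B u v u' v') : OrdEq B A (ng v) (ng u) (ng v') (ng u') where
  uu := fun i j hi hj => by have := o.vv j i hj hi; simp only [ng]; omega
  vv := fun i j hi hj => by have := o.uu j i hj hi; simp only [ng]; omega
  uv := fun i j hi hj => by have := o.uv j i hj hi; simp only [ng]; omega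
  vu := fun i j hi hj => by have := o.vu j i hj hi; simp only [ng]; omega

theorem OrdEq.sys (o : OrdEq A B u v u' v') (h : Sys A B u v) : Sys A B u' v' := by
  refine mkSys ?_ ?_ ?_ ?_ ?_ ?_ ?_ ?_ ?_
  · have := o.uv 0 0 (by omega) (by omega)
    have := o.vu 0 0 (by omega) (by omega)
    have := h.h0
    omega
  · intro i hi
    rw [← o.uu _ _ (by omega) (by omega), ← o.uu _ _ (by omega) (by omega)]
    exact h.mvU i hi
  · intro i hi
    rw [← o.vv _ _ (by omega) (by omega), ← o.vv _ _ (by omega) (by omega)]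
    exact h.mvV i hi
  · intro i j hi hj e
    have := h.ncU i j hi hj e
    unfold NC at *
    rw [o.uu i j (by omega) (by omega), o.uu j (i+1) (by omega) (by omega),
      o.uu (i+1) j (by omega) (by omega), o.uu j i (by omega) (by omega),
      o.uu i (j+1) (by omega) (by omega), o.uu (j+1) (i+1) (by omega) (by omega),
      o.uu (i+1) (j+1) (by omega) (by omega), o.uu (j+1) i (by omega) (by omega)] at this
    exact this
  · intro i j hi hj e
    have := h.ncV i j hi hj e
    unfold NC at *
    rw [o.vv i j (by omega) (by omega), o.vv j (i+1) (by omega) (by omega),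
      o.vv (i+1) j (by omega) (by omega), o.vv j i (by omega) (by omega),
      o.vv i (j+1) (by omega) (by omega), o.vv (j+1) (i+1) (by omega) (by omega),
      o.vv (i+1) (j+1) (by omega) (by omega), o.vv (j+1) i (by omega) (by omega)] at this
    exact this
  · intro i j hi hj e
    have := h.ncUV i j hi hj e
    unfold NC at *
    rw [o.uv i j (by omega) (by omega), o.vu (i+1) j (by omega) (by omega),
      o.uv (i+1) j (by omega) (by omega), o.vu i j (by omega) (by omega),
      o.uv i (j+1) (by omega) (by omega), o.vu (i+1) (j+1) (by omega) (by omega),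
      o.uv (i+1) (j+1) (by omega) (by omega), o.vu i (j+1) (by omega) (by omega)] at this
    exact this
  · intro i j hi hj e
    have := o.uu i j hi hj
    have := o.uu j i hj hi
    have := h.injU i j hi hj (by omega)
    omega
  · intro i j hi hj e
    have := o.vv i j hi hj
    have := o.vv j i hj hi
    have := h.injV i j hi hj (by omega)
    omega
  · intro i j hi hj e
    have := o.uv i j hi hj
    have := o.vu i j hi hj
    have := h.injUV i j hi hj (by omega)
    omega

theorem OrdEq.spine {k1 : ℕ} (o : OrdEq A B u v u' v') (h : Spine A u k1) : Spine A u' k1 := by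
  have hle := h.le
  refine ⟨h.pos, h.le, ?_, ?_⟩
  · intro k hk hk1
    have := h.out k hk hk1
    unfold Out at *
    rw [← o.uu _ _ (by omega) (by omega), ← o.uu _ _ (by omega) (by omega)]
    exact this
  · intro hlt
    have := h.turn hlt
    unfold Out at *
    rw [← o.uu _ _ (by omega) (by omega), ← o.uu _ _ (by omega) (by omega)]
    exact this

theorem OrdEq.acc {k1 k2 j : ℕ} (o : OrdEq A B u v u' v') (h1 : k1 + j ≤ A) (h2 : k2 + j ≤ B) :
    Acc u v k1 k2 j ↔ Acc u' v' k1 k2 j := by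
  unfold Acc
  rw [o.uv _ _ h1 h2, o.vu _ _ h1 h2]

theorem OrdEq.tc {k1 k2 t : ℕ} (hBA : B ≤ A + 1) (o : OrdEq A B u v u' v')
    (h : TC B u v k1 k2 t) : TC B u' v' k1 k2 t := by
  refine ⟨fun e => ?_, h.nadj⟩
  obtain ⟨x, y, z⟩ := h.adj e
  refine ⟨x, fun j hj => ?_, fun hlt => ?_⟩
  · exact (o.acc (by omega) (by omega)).1 (y j hj)
  · exact fun hh => z hlt ((o.acc (by omega) (by omega)).2 hh)

theorem OrdEq.conf {k1 k2 t : ℕ} (hBA : B ≤ A + 1) (hAB : A ≤ B + 1)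
    (o : OrdEq A B u v u' v') (h : Conf A B u v k1 k2 t) : Conf A B u' v' k1 k2 t :=
  ⟨o.spine h.s1, o.swap.spine h.s2, fun hk => o.tc hBA (h.tle hk),
    fun hk => o.swap.tc hAB (h.tgt hk)⟩

theorem OrdEq.of_conf {k1 k2 t : ℕ} (hBA : B ≤ A + 1) (hAB : A ≤ B + 1)
    (h : Sys A B u v) (c : Conf A B u v k1 k2 t) (h' : Sys A B u' v')
    (c' : Conf A B u' v' k1 k2 t) : OrdEq A B u v u' v' where
  uu := fun i j hi hj => half_det h.half c.s1 h'.half c'.s1 hi hj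
  vv := fun i j hi hj => by
    have := half_det h.swap.half c.s2 h'.swap.half c'.s2 hj hi
    simp only [ng] at this
    omega
  uv := fun i j hi hj => Conf.det hBA hAB h c h' c' hi hj
  vu := fun i j hi hj => by
    have d := Conf.det hBA hAB h c h' c' hi hj
    rcases Nat.eq_zero_or_pos (i + j) with e | e
    · obtain rfl : i = 0 := by omega
      obtain rfl : j = 0 := by omega
      rw [h.h0, h'.h0]
      simp
    · have := h.injUV i j hi hj e
      have := h'.injUV i j hi hj e
      omega

end ord

/-! ### Link with permutations -/

theorem perm_eq_of_lt {n : ℕ} (σ τ : Equiv.Perm (Fin n)) (h : ∀ i j, σ i < σ j ↔ τ i < τ j) :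
    σ = τ := by
  let e : Fin n ≃o Fin n :=
    { toEquiv := σ.symm.trans τ
      map_rel_iff' := by
        intro x y
        have := h (σ.symm y) (σ.symm x)
        simp only [Equiv.apply_symm_apply] at this
        simp only [Equiv.trans_apply]
        rw [← not_lt, ← not_lt, this] }
  have he : e = OrderIso.refl _ := Subsingleton.elim _ _
  ext i
  have : e (σ i) = σ i := by rw [he]; rfl
  have h2 : e (σ i) = τ i := by
    change τ (σ.symm (σ i)) = τ i
    simp
  rw [← h2, this]

theorem exists_perm {n : ℕ} (f : Fin n → ℤ) (hf : Function.Injective f) :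
    ∃ σ : Equiv.Perm (Fin n), ∀ i j, σ i < σ j ↔ f i < f j := by
  refine ⟨(Tuple.sort f).symm, fun i j => ?_⟩
  have hm : StrictMono (f ∘ Tuple.sort f) :=
    (Tuple.monotone_sort f).strictMono_of_injective (hf.comp (Tuple.sort f).injective)
  have := hm.lt_iff_lt (a := (Tuple.sort f).symm i) (b := (Tuple.sort f).symm j)
  simpa using this.symm

theorem NC_sg_iff {x y z w : ℤ} (k : ℕ) : NC (sg k x) (sg k y) (sg k z) (sg k w) ↔ NC x y z w := by
  refine ⟨fun h => ?_, fun h => h.sg k⟩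
  unfold sg at h
  split_ifs at h
  · exact h
  · simpa using h.neg

theorem NC_swap1 {x y z w : ℤ} : NC x y z w ↔ NC y x z w := by
  unfold NC; constructor <;> intro h <;> omega

theorem NC_swap2 {x y z w : ℤ} : NC x y z w ↔ NC x y w z := by
  unfold NC; constructor <;> intro h <;> omega

theorem nocross_iff (x y z w : ℕ) :
    ¬ Xor' (StrictlyBetween z x y) (StrictlyBetween w x y) ↔ NC x y z w := by
  have key : ∀ c : ℕ, StrictlyBetween c x y ↔
      (((x : ℤ) < c ∧ (c : ℤ) < y) ∨ ((y : ℤ) < c ∧ (c : ℤ) < x)) := by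
    intro c
    unfold StrictlyBetween
    omega
  have gen : ∀ P Q : Prop, ¬ Xor' P Q ↔ (P ↔ Q) := by
    intro P Q
    by_cases hP : P <;> by_cases hQ : Q <;> simp [Xor', hP, hQ]
  rw [key, key, gen, NC]

noncomputable def uS (a : ℕ) {n : ℕ} (σ : Equiv.Perm (Fin n)) (k : ℕ) : ℤ :=
  sg a (faceVal σ (a - k) : ℤ)

noncomputable def vS (a : ℕ) {n : ℕ} (σ : Equiv.Perm (Fin n)) (k : ℕ) : ℤ :=
  sg a (faceVal σ (a + k) : ℤ)

theorem faceVal_inj {n : ℕ} (σ : Equiv.Perm (Fin n)) {i j : ℕ} (hi : i < n) (hj : j < n)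
    (h : i ≠ j) : (faceVal σ i : ℤ) ≠ faceVal σ j := by
  unfold faceVal
  rw [dif_pos hi, dif_pos hj]
  intro e
  have : σ ⟨i, hi⟩ = σ ⟨j, hj⟩ := Fin.ext (by exact_mod_cast e)
  have := σ.injective this
  simp at this
  exact h this

theorem mv_iff (a i : ℕ) (P Q : Prop) :
    (if ((if i < a then MV.M else MV.V) = MV.M ∧ Even i) ∨
        ((if i < a then MV.M else MV.V) = MV.V ∧ Odd i) then P else Q) ↔
      ((i < a ∧ i % 2 = 0) ∨ (a ≤ i ∧ i % 2 = 1) → P) ∧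
      ((i < a ∧ i % 2 = 1) ∨ (a ≤ i ∧ i % 2 = 0) → Q) := by
  rcases Nat.lt_or_ge i a with h | h
  · rcases Nat.mod_two_eq_zero_or_one i with e | e <;> simp [h, e, Nat.even_iff, Nat.odd_iff, not_le.mpr h]
  · rcases Nat.mod_two_eq_zero_or_one i with e | e <;> simp [h, e, Nat.even_iff, Nat.odd_iff, not_lt.mpr h]

theorem valid_sys {a : ℕ} (σ : Equiv.Perm (Fin (a + (a + 1) + 1)))
    (h : ValidLayerOrdering (a + (a + 1) + 1) (fun i => if i < a then MV.M else MV.V) σ) :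
    Sys a (a + 1) (uS a σ) (vS a σ) := by
  obtain ⟨h1, h2⟩ := h
  have nc : ∀ i j, i + 1 < a + (a + 1) + 1 → j + 1 < a + (a + 1) + 1 → i % 2 = j % 2 →
      NC (faceVal σ i) (faceVal σ (i+1)) (faceVal σ j) (faceVal σ (j+1)) :=
    fun i j hi hj e => (nocross_iff _ _ _ _).1 (h2 i j hi hj e)
  have mv : ∀ i, i + 1 < a + (a + 1) + 1 → _ := fun i hi => (mv_iff a i _ _).1 (h1 i hi)
  refine mkSys ?_ ?_ ?_ ?_ ?_ ?_ ?_ ?_ ?_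
  · simp [uS, vS]
  · intro i hi
    have := mv (a - (i + 1)) (by omega)
    have c1 := sg_cases a (faceVal σ (a - i))
    have c2 := sg_cases a (faceVal σ (a - (i + 1)))
    rw [show a - (i + 1) + 1 = a - i by omega] at this
    unfold uS
    omega
  · intro i hi
    have := mv (a + i) (by omega)
    have c1 := sg_cases a (faceVal σ (a + i))
    have c2 := sg_cases a (faceVal σ (a + i + 1))
    unfold vS
    rw [show a + (i + 1) = a + i + 1 by omega]
    omega
  · intro i j hi hj e
    unfold uS
    rw [NC_sg_iff, NC_swap1, NC_swap2]
    have := nc (a - (i + 1)) (a - (j + 1)) (by omega) (by omega) (by omega)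
    rwa [show a - (i + 1) + 1 = a - i by omega, show a - (j + 1) + 1 = a - j by omega] at this
  · intro i j hi hj e
    unfold vS
    rw [NC_sg_iff]
    exact nc (a + i) (a + j) (by omega) (by omega) (by omega)
  · intro i j hi hj e
    unfold uS vS
    rw [NC_sg_iff, NC_swap1]
    have := nc (a - (i + 1)) (a + j) (by omega) (by omega) (by omega)
    rwa [show a - (i + 1) + 1 = a - i by omega] at this
  · intro i j hi hj e
    exact sg_inj (faceVal_inj σ (by omega) (by omega) (by omega))
  · intro i j hi hj e
    exact sg_inj (faceVal_inj σ (by omega) (by omega) (by omega))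
  · intro i j hi hj e
    exact sg_inj (faceVal_inj σ (by omega) (by omega) (by omega))

theorem sys_valid {a : ℕ} (σ : Equiv.Perm (Fin (a + (a + 1) + 1)))
    (h : Sys a (a + 1) (uS a σ) (vS a σ)) :
    ValidLayerOrdering (a + (a + 1) + 1) (fun i => if i < a then MV.M else MV.V) σ := by
  refine ⟨fun i hi => ?_, fun i j hi hj e => ?_⟩
  · rw [mv_iff]
    rcases Nat.lt_or_ge i a with hlt | hge
    · obtain ⟨k, rfl⟩ : ∃ k, a = i + 1 + k := ⟨a - (i + 1), by omega⟩
      have := h.mvU k (by omega)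
      unfold uS at this
      have c1 := sg_cases (i + 1 + k) (faceVal σ (i + 1))
      have c2 := sg_cases (i + 1 + k) (faceVal σ i)
      rw [show i + 1 + k - k = i + 1 by omega, show i + 1 + k - (k + 1) = i by omega] at this
      omega
    · obtain ⟨k, rfl⟩ : ∃ k, i = a + k := ⟨i - a, by omega⟩
      have := h.mvV k (by omega)
      unfold vS at this
      have c1 := sg_cases a (faceVal σ (a + k))
      have c2 := sg_cases a (faceVal σ (a + k + 1))
      rw [show a + (k + 1) = a + k + 1 by omega] at this
      omega
  · rw [nocross_iff]
    rcases Nat.lt_or_ge i a with hlt | hge <;> rcases Nat.lt_or_ge j a with hlt' | hge'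
    · have := h.ncU (a - (i + 1)) (a - (j + 1)) (by omega) (by omega) (by omega)
      unfold uS at this
      rw [NC_sg_iff, NC_swap1, NC_swap2] at this
      rwa [show a - (a - (i + 1) + 1) = i by omega, show a - (a - (i + 1)) = i + 1 by omega,
        show a - (a - (j + 1) + 1) = j by omega, show a - (a - (j + 1)) = j + 1 by omega] at this
    · have := h.ncUV (a - (i + 1)) (j - a) (by omega) (by omega) (by omega)
      unfold uS vS at this
      rw [NC_sg_iff, NC_swap1] at this
      rwa [show a - (a - (i + 1) + 1) = i by omega, show a - (a - (i + 1)) = i + 1 by omega,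
        show a + (j - a + 1) = j + 1 by omega, show a + (j - a) = j by omega] at this
    · have := h.ncVU (a - (j + 1)) (i - a) (by omega) (by omega) (by omega)
      unfold uS vS at this
      rw [NC_sg_iff, NC_swap2] at this
      rwa [show a - (a - (j + 1) + 1) = j by omega, show a - (a - (j + 1)) = j + 1 by omega,
        show a + (i - a + 1) = i + 1 by omega, show a + (i - a) = i by omega] at this
    · have := h.ncV (i - a) (j - a) (by omega) (by omega) (by omega)
      unfold vS at this
      rw [NC_sg_iff] at this
      rwa [show a + (i - a + 1) = i + 1 by omega, show a + (i - a) = i by omega,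
        show a + (j - a + 1) = j + 1 by omega, show a + (j - a) = j by omega] at this

theorem sg_lt_congr {k : ℕ} {x y x' y' : ℤ} (h1 : x < y ↔ x' < y') (h2 : y < x ↔ y' < x') :
    sg k x < sg k y ↔ sg k x' < sg k y' := by
  unfold sg; split_ifs <;> omega

theorem sg_sg (k : ℕ) (x : ℤ) : sg k (sg k x) = x := by
  unfold sg; split_ifs <;> simp

/-- Two valid orderings with equivalent half-orders agree. -/
theorem perm_eq_of_ordEq {a : ℕ} (σ τ : Equiv.Perm (Fin (a + (a + 1) + 1)))
    (o : OrdEq a (a + 1) (uS a σ) (vS a σ) (uS a τ) (vS a τ)) : σ = τ := by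
  apply perm_eq_of_lt
  have key : ∀ i j, i < a + (a + 1) + 1 → j < a + (a + 1) + 1 →
      (sg a (faceVal σ i) < sg a (faceVal σ j) ↔ sg a (faceVal τ i) < sg a (faceVal τ j)) := by
    intro i j hi hj
    rcases Nat.lt_or_ge i a with hlt | hge <;> rcases Nat.lt_or_ge j a with hlt' | hge'
    · have := o.uu (a - i) (a - j) (by omega) (by omega)
      unfold uS at this
      rwa [show a - (a - i) = i by omega, show a - (a - j) = j by omega] at this
    · have := o.uv (a - i) (j - a) (by omega) (by omega)
      unfold uS vS at this
      rwa [show a - (a - i) = i by omega, show a + (j - a) = j by omega] at this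
    · have := o.vu (a - j) (i - a) (by omega) (by omega)
      unfold uS vS at this
      rwa [show a - (a - j) = j by omega, show a + (i - a) = i by omega] at this
    · have := o.vv (i - a) (j - a) (by omega) (by omega)
      unfold vS at this
      rwa [show a + (i - a) = i by omega, show a + (j - a) = j by omega] at this
  intro i j
  have k1 := key i j i.2 j.2
  have k2 := key j i j.2 i.2
  have k3 := sg_lt_congr (k := a) k1 k2
  rw [sg_sg, sg_sg, sg_sg, sg_sg] at k3
  unfold faceVal at k3
  rw [dif_pos i.2, dif_pos j.2, dif_pos i.2, dif_pos j.2] at k3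
  rw [Fin.lt_def, Fin.lt_def]
  exact_mod_cast k3

/-- Every system is realised by a permutation. -/
theorem exists_perm_ordEq {a : ℕ} {u v : ℕ → ℤ} (h : Sys a (a + 1) u v) :
    ∃ σ : Equiv.Perm (Fin (a + (a + 1) + 1)), OrdEq a (a + 1) u v (uS a σ) (vS a σ) := by
  obtain ⟨F, hF1, hF2⟩ : ∃ F : ℕ → ℤ, (∀ k, k ≤ a → F (a - k) = u k) ∧ (∀ k, F (a + k) = v k) := by
    refine ⟨fun i => if i < a then u (a - i) else v (i - a), fun k hk => ?_, fun k => ?_⟩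
    · rcases Nat.eq_zero_or_pos k with rfl | hp
      · simp [h.h0]
      · simp [show a - k < a by omega, show a - (a - k) = k by omega]
    · simp
  have hinj : ∀ i j, i < a + (a + 1) + 1 → j < a + (a + 1) + 1 → i < j → F i ≠ F j := by
    intro i j hi hj hij
    rcases Nat.lt_or_ge i a with hlt | hge
    · rw [show i = a - (a - i) by omega, hF1 _ (by omega)]
      rcases Nat.lt_or_ge j a with hlt' | hge'
      · rw [show j = a - (a - j) by omega, hF1 _ (by omega)]
        exact h.injU _ _ (by omega) (by omega) (by omega)
      · rw [show j = a + (j - a) by omega, hF2]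
        exact h.injUV _ _ (by omega) (by omega) (by omega)
    · rw [show i = a + (i - a) by omega, show j = a + (j - a) by omega, hF2, hF2]
      exact h.injV _ _ (by omega) (by omega) (by omega)
  obtain ⟨σ, hσ⟩ := exists_perm (n := a + (a + 1) + 1) (fun i => sg a (F i)) (by
    intro i j hij
    by_contra hne
    have hne' : (i : ℕ) ≠ j := fun hh => hne (Fin.ext hh)
    rcases lt_or_gt_of_ne hne' with hl | hl
    · exact sg_inj (hinj i j i.2 j.2 hl) hij
    · exact sg_inj (hinj j i j.2 i.2 hl) hij.symm)
  have key : ∀ i j, i < a + (a + 1) + 1 → j < a + (a + 1) + 1 →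
      (F i < F j ↔ sg a (faceVal σ i) < sg a (faceVal σ j)) := by
    intro i j hi hj
    have k1 := hσ ⟨i, hi⟩ ⟨j, hj⟩
    have k2 := hσ ⟨j, hj⟩ ⟨i, hi⟩
    have e1 : ((faceVal σ i : ℕ) : ℤ) < faceVal σ j ↔ sg a (F i) < sg a (F j) := by
      rw [← k1, Fin.lt_def]
      unfold faceVal
      rw [dif_pos hi, dif_pos hj]
      norm_cast
    have e2 : ((faceVal σ j : ℕ) : ℤ) < faceVal σ i ↔ sg a (F j) < sg a (F i) := by
      rw [← k2, Fin.lt_def]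
      unfold faceVal
      rw [dif_pos hi, dif_pos hj]
      norm_cast
    have := sg_lt_congr (k := a) e1 e2
    rw [sg_sg, sg_sg] at this
    exact this.symm
  refine ⟨σ, ?_, ?_, ?_, ?_⟩
  · intro i j hi hj
    rw [← hF1 i hi, ← hF1 j hj]
    exact key _ _ (by omega) (by omega)
  · intro i j hi hj
    rw [← hF2 i, ← hF2 j]
    exact key _ _ (by omega) (by omega)
  · intro i j hi hj
    rw [← hF1 i hi, ← hF2 j]
    exact key _ _ (by omega) (by omega)
  · intro i j hi hj
    rw [← hF1 i hi, ← hF2 j]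
    exact key _ _ (by omega) (by omega)

/-! ### Counting -/

def wt (a k1 k2 : ℕ) : ℕ :=
  1 + ((if k2 = k1 + 1 then a - k1 else 0) + (if k1 = k2 + 1 then a - k1 else 0))

def Params (a : ℕ) : Finset ((_ : ℕ × ℕ) × ℕ) :=
  (Finset.Icc 1 a ×ˢ Finset.Icc 1 (a + 1)).sigma (fun p => Finset.range (wt a p.1 p.2))

theorem mem_Params {a : ℕ} {p : (_ : ℕ × ℕ) × ℕ} :
    p ∈ Params a ↔ Par a (a + 1) p.1.1 p.1.2 p.2 := by
  simp only [Params, Finset.mem_sigma, Finset.mem_product, Finset.mem_Icc, Finset.mem_range, wt, Par]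
  split_ifs <;> omega

theorem inner_sum (a k : ℕ) (hk : 1 ≤ k) (hka : k ≤ a) :
    ∑ l ∈ Finset.Icc 1 (a + 1), wt a k l = (a + 1) + ((a - k) + if k = 1 then 0 else a - k) := by
  unfold wt
  rw [Finset.sum_add_distrib, Finset.sum_add_distrib]
  congr 1
  · simp
  congr 1
  · rw [Finset.sum_ite_eq' (Finset.Icc 1 (a + 1)) (k + 1) (fun _ => a - k)]
    rw [if_pos (by simp; omega)]
  · have : ∀ l, (k = l + 1) = (l = k - 1) := fun l => by
      apply propext; omega
    rw [Finset.sum_congr rfl (fun l _ => if_congr (iff_of_eq (this l)) rfl rfl)]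
    rw [Finset.sum_ite_eq' (Finset.Icc 1 (a + 1)) (k - 1) (fun _ => a - k)]
    by_cases h : k = 1
    · simp [h]
    · rw [if_pos (by simp; omega), if_neg h]

theorem outer_sum (a m : ℕ) (hm : 1 ≤ m) (hma : m ≤ a) :
    ((∑ k ∈ Finset.Icc 1 m, ((a + 1) + ((a - k) + if k = 1 then 0 else a - k)) : ℕ) : ℤ) =
      m * (a + 1) + (2 * m - 1) * a - m * (m + 1) + 1 := by
  induction m, hm using Nat.le_induction with
  | base =>
    simp
    omega
  | succ m hm ih =>
    rw [Finset.sum_Icc_succ_top (by omega)]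
    rw [if_neg (show ¬ (m + 1 = 1) by omega), Nat.cast_add, ih (by omega)]
    push_cast
    rw [Nat.cast_sub (show m + 1 ≤ a by omega)]
    push_cast
    ring

theorem card_Params (a : ℕ) (ha : 1 ≤ a) : (Params a).card = 2 * a ^ 2 - a + 1 := by
  have h1 : (Params a).card =
      ∑ k ∈ Finset.Icc 1 a, ((a + 1) + ((a - k) + if k = 1 then 0 else a - k)) := by
    unfold Params
    rw [Finset.card_sigma]
    simp only [Finset.card_range]
    rw [Finset.sum_product]
    apply Finset.sum_congr rfl
    intro k hk
    rw [Finset.mem_Icc] at hk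
    exact inner_sum a k hk.1 hk.2
  have h2 := outer_sum a a ha le_rfl
  rw [← h1] at h2
  have h3 : a ≤ 2 * a ^ 2 := by nlinarith
  zify [h3]
  rw [h2]
  ring

theorem count_main (a : ℕ) (ha : 1 ≤ a) :
    Nat.card {σ : Equiv.Perm (Fin (a + (a + 1) + 1)) //
      ValidLayerOrdering (a + (a + 1) + 1) (fun i => if i < a then MV.M else MV.V) σ} =
      2 * a ^ 2 - a + 1 := by
  have hex : ∀ σ : {σ : Equiv.Perm (Fin (a + (a + 1) + 1)) //
      ValidLayerOrdering (a + (a + 1) + 1) (fun i => if i < a then MV.M else MV.V) σ},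
      ∃ p : (Params a : Finset _), Conf a (a + 1) (uS a σ.1) (vS a σ.1) p.1.1.1 p.1.1.2 p.1.2 := by
    intro σ
    obtain ⟨k1, k2, t, c⟩ := Conf.exists ha (by omega) (valid_sys σ.1 σ.2)
    exact ⟨⟨⟨(k1, k2), t⟩, mem_Params.2 c.par⟩, c⟩
  choose g hg using hex
  have hbij : Function.Bijective g := by
    constructor
    · intro σ τ e
      apply Subtype.ext
      apply perm_eq_of_ordEq
      have h1 := hg σ
      rw [e] at h1
      exact OrdEq.of_conf (by omega) (by omega) (valid_sys σ.1 σ.2) h1 (valid_sys τ.1 τ.2) (hg τ)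
    · rintro ⟨⟨⟨k1, k2⟩, t⟩, hp⟩
      obtain ⟨u, v, hs, c⟩ := exists_model (A := a) (B := a + 1) (by omega) (by omega)
        (mem_Params.1 hp)
      obtain ⟨σ, o⟩ := exists_perm_ordEq hs
      refine ⟨⟨σ, sys_valid σ (o.sys hs)⟩, ?_⟩
      have c' := o.conf (by omega) (by omega) c
      obtain ⟨e1, e2, e3⟩ := (hg ⟨σ, sys_valid σ (o.sys hs)⟩).unique c'
      apply Subtype.ext
      generalize (g ⟨σ, sys_valid σ (o.sys hs)⟩).1 = q at *
      obtain ⟨⟨q1, q2⟩, q3⟩ := q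
      simp only at e1 e2 e3
      subst e1 e2 e3
      rfl
  rw [Nat.card_congr (Equiv.ofBijective g hbij), Nat.card_eq_fintype_card, Fintype.card_coe,
    card_Params a ha]

end Stamp

/-- Theorem: for `a ≥ 4`, the assignment `M^a V^{a+1}` on the `1 × (2a+2)` strip
folds in `2a² − a + 1` ways. -/
theorem stmt3 (a : ℕ) (ha : 4 ≤ a) :
    foldCount (a + (a + 1) + 1) (fun i => if i < a then MV.M else MV.V) =
      2 * a ^ 2 - a + 1 := by
  exact Stamp.count_main a (by omega)
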